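/- arXiv:2605.25116 — 8 statements merged into one kernel-verified Lean document; each statement's English description precedes it below -/
import Mathlib

section
/- For every ε with 0 < ε < 1, all t₀, t₁ ∈ [ε, 2−ε], and all θ₁, θ₂ ∈ ℝ, one has |f(t₀, θ₁) − f(t₁, θ₂)| ≤ 4·√(2(1−ε))/ε + 2π/√(1−ε). In particular, taking ε = 1/2 and t₀ = t₁ = 1, |f(1, θ₁) − f(1, θ₂)| ≤ 8 + 2√2·π for all θ₁, θ₂ ∈ ℝ. -/
open Set Real

/-- A function whose derivative is dominated by that of `G` varies at most as much as `G`. -/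
theorem abs_sub_le_sub_of_abs_deriv_le {g G g' G' : ℝ → ℝ} {a b : ℝ} (hab : a ≤ b)
    (hg : ∀ x ∈ Icc a b, HasDerivAt g (g' x) x) (hG : ∀ x ∈ Icc a b, HasDerivAt G (G' x) x)
    (h : ∀ x ∈ Icc a b, |g' x| ≤ G' x) : |g b - g a| ≤ G b - G a := by
  have mono : ∀ F F' : ℝ → ℝ, (∀ x ∈ Icc a b, HasDerivAt F (F' x) x) →
      (∀ x ∈ Icc a b, 0 ≤ F' x) → F a ≤ F b := by
    intro F F' hF hF'
    refine monotoneOn_of_deriv_nonneg (convex_Icc a b)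
      (fun x hx => (hF x hx).continuousAt.continuousWithinAt)
      (fun x hx => (hF x (interior_subset hx)).differentiableAt.differentiableWithinAt)
      (fun x hx => ?_) (left_mem_Icc.2 hab) (right_mem_Icc.2 hab) hab
    rw [(hF x (interior_subset hx)).deriv]
    exact hF' x (interior_subset hx)
  have h1 := mono (fun x => G x - g x) (fun x => G' x - g' x)
    (fun x hx => (hG x hx).sub (hg x hx)) (fun x hx => by linarith [(abs_le.1 (h x hx)).2])
  have h2 := mono (fun x => G x + g x) (fun x => G' x + g' x)
    (fun x hx => (hG x hx).add (hg x hx)) (fun x hx => by linarith [(abs_le.1 (h x hx)).1])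
  rw [abs_le]
  constructor <;> linarith

/-- If `h'² ≤ -w''/w`, then `h` varies at most as much as the primitive
`c t / 2 - w' / (2 c w)`, for every `c > 0`. -/
theorem abs_sub_le_of_sq_deriv_le_neg_deriv_deriv_div {w h : ℝ → ℝ} {s t c : ℝ}
    (hw : ContDiff ℝ 2 w) (hh : Differentiable ℝ h) (hc : 0 < c) (hst : s ≤ t)
    (hpos : ∀ x ∈ Icc s t, 0 < w x)
    (hbound : ∀ x ∈ Icc s t, deriv h x ^ 2 ≤ -deriv (deriv w) x / w x) :
    |h t - h s| ≤
      c / 2 * (t - s) + (deriv w s / w s - deriv w t / w t) / (2 * c) := by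
  have hw1 : Differentiable ℝ w := hw.differentiable (by norm_num)
  have hw2 : Differentiable ℝ (deriv w) :=
    (ContDiff.deriv' (n := 1) (by simpa [one_add_one_eq_two] using hw)).differentiable (by norm_num)
  have key := abs_sub_le_sub_of_abs_deriv_le (g := h) (g' := deriv h)
    (G := fun x => c / 2 * x - deriv w x / w x / (2 * c))
    (G' := fun x => c / 2 * 1 -
      (deriv (deriv w) x * w x - deriv w x * deriv w x) / w x ^ 2 / (2 * c)) hst
    (fun x _ => (hh x).hasDerivAt)
    (fun x hx => ((hasDerivAt_id x).const_mul (c / 2)).sub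
      (((hw2 x).hasDerivAt.div (hw1 x).hasDerivAt (hpos x hx).ne').div_const (2 * c)))
    (fun x hx => by
      have hp := hpos x hx
      have e : c / 2 * 1 -
          (deriv (deriv w) x * w x - deriv w x * deriv w x) / w x ^ 2 / (2 * c)
          = (c ^ 2 + -deriv (deriv w) x / w x + (deriv w x / w x) ^ 2) / (2 * c) := by
        field_simp
        ring
      rw [e, le_div_iff₀ (by positivity)]
      nlinarith [hbound x hx, sq_abs (deriv h x), sq_nonneg (|deriv h x| - c),
        sq_nonneg (deriv w x / w x)])
  refine key.trans (le_of_eq ?_)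
  ring

/-- A differentiable periodic function with derivative bounded by `C` oscillates by at most
`C` times the period. -/
theorem Function.Periodic.abs_sub_le_of_abs_deriv_le {g : ℝ → ℝ} {T C : ℝ}
    (hg : Function.Periodic g T) (hT : 0 < T) (hd : Differentiable ℝ g)
    (hC : ∀ x, |deriv g x| ≤ C) (x y : ℝ) : |g x - g y| ≤ C * T := by
  obtain ⟨z, hz, hxz⟩ := hg.exists_mem_Ico hT x y
  have hC0 : 0 ≤ C := (abs_nonneg _).trans (hC 0)
  have := Convex.norm_image_sub_le_of_norm_deriv_le (f := g) (s := univ) (C := C)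
    (fun x _ => hd x) (fun x _ => hC x) convex_univ (mem_univ y) (mem_univ z)
  rw [hxz]
  refine this.trans (mul_le_mul_of_nonneg_left ?_ hC0)
  rw [Real.norm_eq_abs, abs_of_nonneg (by linarith [hz.1])]
  linarith [hz.2]


/-- Let `w : ℝ → ℝ` be smooth, concave on `[0,2]`, with
`w 0 = w 2 = 0`, `w' 0 = 1`, `w' 2 = −1`, and `w > 0` on `(0,2)`.
Let `f : ℝ → ℝ → ℝ` be smooth, `2π`-periodic in the second variable, with
`(∂_t f)² + w(t)⁻²·(∂_θ f)² ≤ −w''(t)/w(t)` on `(0,2) × ℝ`.  Then for every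
`0 < ε < 1`, all `t₀, t₁ ∈ [ε, 2−ε]` and all `θ₁, θ₂`,
`|f(t₀,θ₁) − f(t₁,θ₂)| ≤ 4√(2(1−ε))/ε + 2π/√(1−ε)`; in particular
`|f(1,θ₁) − f(1,θ₂)| ≤ 8 + 2√2·π`. -/
theorem oscillation_bound_for_f (w : ℝ → ℝ) (f : ℝ → ℝ → ℝ)
    (hw : ContDiff ℝ (⊤ : ℕ∞) w)
    (hconc : ConcaveOn ℝ (Set.Icc 0 2) w)
    (h0 : w 0 = 0) (h2 : w 2 = 0)
    (hd0 : deriv w 0 = 1) (hd2 : deriv w 2 = -1)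
    (hwpos : ∀ t ∈ Set.Ioo (0 : ℝ) 2, 0 < w t)
    (hf : ContDiff ℝ (⊤ : ℕ∞) (Function.uncurry f))
    (hper : ∀ t θ : ℝ, f t (θ + 2 * Real.pi) = f t θ)
    (hgrad : ∀ t ∈ Set.Ioo (0 : ℝ) 2, ∀ θ : ℝ,
      (deriv (fun s => f s θ) t) ^ 2 + ((w t) ^ 2)⁻¹ * (deriv (fun s => f t s) θ) ^ 2
        ≤ -(deriv (deriv w) t) / w t) :
    (∀ ε : ℝ, 0 < ε → ε < 1 →
      ∀ t₀ ∈ Set.Icc ε (2 - ε), ∀ t₁ ∈ Set.Icc ε (2 - ε), ∀ θ₁ θ₂ : ℝ,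
        |f t₀ θ₁ - f t₁ θ₂| ≤
          4 * Real.sqrt (2 * (1 - ε)) / ε + 2 * Real.pi / Real.sqrt (1 - ε)) ∧
    (∀ θ₁ θ₂ : ℝ, |f 1 θ₁ - f 1 θ₂| ≤ 8 + 2 * Real.sqrt 2 * Real.pi) := by
  have hw1 : Differentiable ℝ w := hw.differentiable (by simp)
  have hw2 : ContDiff ℝ 2 w := contDiff_infty.1 hw 2
  have hdw : Differentiable ℝ (deriv w) :=
    (ContDiff.deriv' (n := 1) (by simpa [one_add_one_eq_two] using hw2)).differentiable
      (by norm_num)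
  have hfd : Differentiable ℝ (Function.uncurry f) := hf.differentiable (by simp)
  have hft : ∀ θ, Differentiable ℝ (fun s => f s θ) := fun θ =>
    hfd.comp (differentiable_id.prodMk (differentiable_const θ))
  have hfθ : ∀ t, Differentiable ℝ (fun s => f t s) := fun t =>
    hfd.comp ((differentiable_const t).prodMk differentiable_id)
  have hlo : ∀ t ∈ Ioo (0 : ℝ) 2, w t ≤ t ∧ deriv w t ≤ w t / t ∧
      w t ≤ 2 - t ∧ -deriv w t ≤ w t / (2 - t) := by
    intro t ht
    have m0 : (0 : ℝ) ∈ Icc (0 : ℝ) 2 := by norm_num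
    have m2 : (2 : ℝ) ∈ Icc (0 : ℝ) 2 := by norm_num
    have mt := Ioo_subset_Icc_self ht
    have p0 : 0 < t := ht.1
    have p2 : 0 < 2 - t := sub_pos.2 ht.2
    have a1 := hconc.slope_le_deriv m0 mt ht.1 (hw1 0)
    have a2 := hconc.deriv_le_slope m0 mt ht.1 (hw1 t)
    have a3 := hconc.slope_le_deriv mt m2 ht.2 (hw1 t)
    have a4 := hconc.deriv_le_slope mt m2 ht.2 (hw1 2)
    rw [slope_def_field, h0, sub_zero, sub_zero] at a1 a2
    rw [slope_def_field, h2, zero_sub, neg_div] at a3 a4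
    rw [hd0, div_le_one p0] at a1
    rw [hd2, neg_le_neg_iff, div_le_one p2] at a4
    exact ⟨a1, a2, a4, by linarith⟩
  have main : ∀ ε : ℝ, 0 < ε → ε < 1 →
      ∀ t₀ ∈ Set.Icc ε (2 - ε), ∀ t₁ ∈ Set.Icc ε (2 - ε), ∀ θ₁ θ₂ : ℝ,
        |f t₀ θ₁ - f t₁ θ₂| ≤
          4 * Real.sqrt (2 * (1 - ε)) / ε + 2 * Real.pi / Real.sqrt (1 - ε) := by
    intro ε hε hε1 t₀ ht₀ t₁ ht₁ θ₁ θ₂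
    have h1ε : 0 < 1 - ε := sub_pos.2 hε1
    have sub : ∀ t ∈ Icc ε (2 - ε), t ∈ Ioo (0 : ℝ) 2 := fun t ht =>
      ⟨hε.trans_le ht.1, by linarith [ht.2]⟩
    have vert_le : ∀ θ : ℝ, ∀ s ∈ Icc ε (2 - ε), ∀ t ∈ Icc ε (2 - ε), s ≤ t →
        |f t θ - f s θ| ≤ 2 * √(2 * (1 - ε)) / ε := by
      intro θ s hs t ht hst
      have hsub : ∀ x ∈ Icc s t, x ∈ Ioo (0 : ℝ) 2 := fun x hx =>
        sub x ⟨hs.1.trans hx.1, hx.2.trans ht.2⟩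
      have hR : 0 < √(2 * (1 - ε)) := by positivity
      have hR2 : √(2 * (1 - ε)) ^ 2 = 2 * (1 - ε) := Real.sq_sqrt (by positivity)
      set R := √(2 * (1 - ε))
      have hc : 0 < 2 / (ε * R) := by positivity
      refine (abs_sub_le_of_sq_deriv_le_neg_deriv_deriv_div hw2 (hft θ) hc hst
        (fun x hx => hwpos x (hsub x hx)) (fun x hx => ?_)).trans ?_
      · refine le_trans ?_ (hgrad x (hsub x hx) θ)
        have : 0 ≤ ((w x) ^ 2)⁻¹ * (deriv (fun s => f x s) θ) ^ 2 := by positivity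
        linarith
      · have hws := hwpos s (sub s hs)
        have hwt := hwpos t (sub t ht)
        have b1 : deriv w s / w s ≤ 1 / ε := by
          refine (div_le_iff₀ hws).2 ((hlo s (sub s hs)).2.1.trans ?_)
          rw [one_div_mul_eq_div]
          exact div_le_div_of_nonneg_left hws.le hε hs.1
        have b2 : -(deriv w t / w t) ≤ 1 / ε := by
          rw [← neg_div]
          refine (div_le_iff₀ hwt).2 ((hlo t (sub t ht)).2.2.2.trans ?_)
          rw [one_div_mul_eq_div]
          exact div_le_div_of_nonneg_left hwt.le hε (by linarith [ht.2])
        calc 2 / (ε * R) / 2 * (t - s) +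
              (deriv w s / w s - deriv w t / w t) / (2 * (2 / (ε * R)))
            ≤ 2 / (ε * R) / 2 * R ^ 2 + (2 / ε) / (2 * (2 / (ε * R))) := by
              gcongr
              · linarith [hs.1, ht.2]
              · have : 2 / ε = 1 / ε + 1 / ε := by ring
                linarith
          _ = R / ε + R / 2 := by field_simp
          _ ≤ R / ε + R / ε := by gcongr; linarith
          _ = 2 * R / ε := by ring
    have vert : ∀ θ : ℝ, ∀ s ∈ Icc ε (2 - ε), ∀ t ∈ Icc ε (2 - ε),
        |f t θ - f s θ| ≤ 2 * √(2 * (1 - ε)) / ε := by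
      intro θ s hs t ht
      rcases le_total s t with h | h
      · exact vert_le θ s hs t ht h
      · rw [abs_sub_comm]
        exact vert_le θ t ht s hs h
    obtain ⟨m, hm, hmd⟩ := exists_deriv_eq_slope (deriv w) (show ε < 2 - ε by linarith)
      hdw.continuous.continuousOn hdw.differentiableOn
    have hmI := Ioo_subset_Icc_self hm
    have hm2 := sub m hmI
    have hwm := hwpos m hm2
    have hmbound : -deriv (deriv w) m ≤ 1 / (1 - ε) := by
      have e1 : ε ∈ Icc ε (2 - ε) := ⟨le_rfl, by linarith⟩
      have e2 : 2 - ε ∈ Icc ε (2 - ε) := ⟨by linarith, le_rfl⟩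
      obtain ⟨a1, a2, -, -⟩ := hlo ε (sub _ e1)
      obtain ⟨-, -, a3, a4⟩ := hlo (2 - ε) (sub _ e2)
      have c1 : deriv w ε ≤ 1 := a2.trans ((div_le_one hε).2 a1)
      have c2 : -deriv w (2 - ε) ≤ 1 := a4.trans ((div_le_one (by linarith)).2 a3)
      rw [hmd, ← neg_div, div_le_div_iff₀ (by linarith) h1ε]
      nlinarith
    have hor : |f m θ₁ - f m θ₂| ≤ 1 / √(1 - ε) * (2 * Real.pi) := by
      refine Function.Periodic.abs_sub_le_of_abs_deriv_le (g := fun s => f m s) (hper m)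
        Real.two_pi_pos (hfθ m) (fun θ => ?_) θ₁ θ₂
      refine abs_le_of_sq_le_sq ?_ (by positivity)
      rw [div_pow, Real.sq_sqrt h1ε.le, one_pow]
      have g1 : ((w m) ^ 2)⁻¹ * (deriv (fun s => f m s) θ) ^ 2 ≤ -deriv (deriv w) m / w m := by
        refine le_trans ?_ (hgrad m hm2 θ)
        have := sq_nonneg (deriv (fun s => f s θ) m)
        linarith
      have w1 : w m ≤ 1 := by linarith [(hlo m hm2).1, (hlo m hm2).2.2.1]
      calc (deriv (fun s => f m s) θ) ^ 2
          = w m ^ 2 * (((w m) ^ 2)⁻¹ * (deriv (fun s => f m s) θ) ^ 2) := by field_simp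
        _ ≤ w m ^ 2 * (-deriv (deriv w) m / w m) := by gcongr
        _ = -deriv (deriv w) m * w m := by field_simp
        _ ≤ 1 / (1 - ε) * w m := by gcongr
        _ ≤ 1 / (1 - ε) * 1 := by gcongr
        _ = 1 / (1 - ε) := mul_one _
    have v1 := vert θ₁ m hmI t₀ ht₀
    have v2 := vert θ₂ t₁ ht₁ m hmI
    calc |f t₀ θ₁ - f t₁ θ₂|
        = |(f t₀ θ₁ - f m θ₁) + (f m θ₁ - f m θ₂) + (f m θ₂ - f t₁ θ₂)| := by congr 1; ring
      _ ≤ |f t₀ θ₁ - f m θ₁| + |f m θ₁ - f m θ₂| + |f m θ₂ - f t₁ θ₂| := abs_add_three _ _ _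
      _ ≤ 2 * √(2 * (1 - ε)) / ε + 1 / √(1 - ε) * (2 * Real.pi) + 2 * √(2 * (1 - ε)) / ε := by
        gcongr
      _ = _ := by ring
  refine ⟨main, fun θ₁ θ₂ => ?_⟩
  have h1 : (1 : ℝ) ∈ Icc (1 / 2 : ℝ) (2 - 1 / 2) := by norm_num
  refine (main (1 / 2) (by norm_num) (by norm_num) 1 h1 1 h1 θ₁ θ₂).trans (le_of_eq ?_)
  have e1 : (2 * (1 - 1 / 2) : ℝ) = 1 := by norm_num
  have e2 : √(1 - 1 / 2 : ℝ) = 1 / √2 := by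
    rw [show (1 - 1 / 2 : ℝ) = 1 / 2 by norm_num, Real.sqrt_div zero_le_one, Real.sqrt_one]
  simp only [e1, e2, Real.sqrt_one, div_div_eq_mul_div]
  ring
end

section
/- For every ε with 0 < ε < 1 there exists a constant C(ε) > 0, depending only on ε (and not on w or f), such that for every t₀ ∈ [ε, 2−ε], −C(ε) ≤ ∫₀^{2π} f(t₀, θ) dθ ≤ C(ε). -/
open Real Set

/-- The tangent line of a concave function lies above its graph. -/
lemma ConcaveOn.le_add_mul_of_hasDerivAt {S : Set ℝ} {w : ℝ → ℝ} {x y w' : ℝ}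
    (hw : ConcaveOn ℝ S w) (hx : x ∈ S) (hy : y ∈ S) (hd : HasDerivAt w w' x) :
    w y ≤ w x + w' * (y - x) := by
  rcases lt_trichotomy x y with h | rfl | h
  · have := hw.slope_le_of_hasDerivAt hx hy h hd
    rw [slope_def_field, div_le_iff₀ (by linarith)] at this
    linarith
  · simp
  · have := hw.le_slope_of_hasDerivAt hy hx h hd
    rw [slope_def_field, le_div_iff₀ (by linarith)] at this
    linarith

/-- A nonnegative concave function on `[0, 2]` is at most twice its value at `1`. -/
lemma ConcaveOn.le_two_mul_of_nonneg {w w' : ℝ → ℝ} (hc : ConcaveOn ℝ (Icc 0 2) w)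
    (h0 : w 0 = 0) (h2 : w 2 = 0) (hw : ∀ t, HasDerivAt w (w' t) t)
    {t : ℝ} (ht : t ∈ Icc (0 : ℝ) 2) : w t ≤ 2 * w 1 := by
  have m1 : (1 : ℝ) ∈ Icc (0 : ℝ) 2 := by norm_num
  have a := hc.le_add_mul_of_hasDerivAt m1 (y := 0) (by norm_num) (hw 1)
  have b := hc.le_add_mul_of_hasDerivAt m1 (y := 2) (by norm_num) (hw 1)
  have d := hc.le_add_mul_of_hasDerivAt m1 ht (hw 1)
  rw [h0] at a
  rw [h2] at b
  nlinarith [ht.1, ht.2]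

/-- A concave function on `[0, 2]` vanishing at the endpoints dominates a parabola. -/
lemma ConcaveOn.parabola_le {w : ℝ → ℝ} (hc : ConcaveOn ℝ (Icc 0 2) w)
    (h0 : w 0 = 0) (h2 : w 2 = 0) (h1 : 0 < w 1)
    {t : ℝ} (ht : t ∈ Icc (0 : ℝ) 2) : w 1 * (t * (2 - t)) / 2 ≤ w t := by
  obtain ⟨ht0, ht2⟩ := ht
  rcases le_total t 1 with h | h
  · have := hc.2 (show (0 : ℝ) ∈ Icc 0 2 by norm_num) (show (1 : ℝ) ∈ Icc 0 2 by norm_num)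
      (show 0 ≤ 1 - t by linarith) ht0 (by ring)
    simp only [smul_eq_mul, h0, mul_zero, mul_one, zero_add] at this
    nlinarith [mul_nonneg h1.le (mul_nonneg ht0 ht0)]
  · have := hc.2 (show (2 : ℝ) ∈ Icc 0 2 by norm_num) (show (1 : ℝ) ∈ Icc 0 2 by norm_num)
      (show 0 ≤ t - 1 by linarith) (show 0 ≤ 2 - t by linarith) (by ring)
    simp only [smul_eq_mul, h2, mul_zero, mul_one, zero_add] at this
    rw [show (t - 1) * 2 + (2 - t) = t by ring] at this
    nlinarith [mul_nonneg h1.le (mul_nonneg (sub_nonneg.2 ht2) (sub_nonneg.2 ht2))]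

lemma mul_abs_le_of_sq_le_div {a b c p s v : ℝ} (ha : 0 ≤ a) (hb : 0 < b) (hs : 0 < s)
    (hab : a ≤ 2 * b) (hbc : b ≤ 2 * c) (hp : p ^ 2 ≤ v / b) :
    a * |p| ≤ s * v + 2 * c / s := by
  have hp' : p ^ 2 * b ≤ v := (le_div_iff₀ hb).1 hp
  have hv : 0 ≤ v := le_trans (by positivity) hp'
  have h1 : a * |p| ≤ s * v + b / s := by
    refine le_of_sq_le_sq ?_ (by positivity)
    have e1 : (s * v + b / s) ^ 2 = (s * v - b / s) ^ 2 + 4 * b * v := by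
      field_simp
      ring
    rw [mul_pow, sq_abs, e1]
    have e2 : a ^ 2 ≤ 4 * b ^ 2 := by nlinarith
    have e3 : a ^ 2 * p ^ 2 ≤ 4 * b ^ 2 * p ^ 2 := by gcongr
    nlinarith [sq_nonneg (s * v - b / s)]
  have h2 : b / s ≤ 2 * c / s := by gcongr
  linarith

/-- If `φ'² ≤ -w''/w` on the left half of `[0, 2]`, the oscillation of `φ` is controlled there. -/
lemma abs_sub_mul_le_of_le_one {w w' w'' φ φ' : ℝ → ℝ} (hc : ConcaveOn ℝ (Icc 0 2) w)
    (h0 : w 0 = 0) (h2 : w 2 = 0) (hpos : ∀ t ∈ Ioo (0 : ℝ) 2, 0 < w t)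
    (hw : ∀ t, HasDerivAt w (w' t) t) (hw' : ∀ t, HasDerivAt w' (w'' t) t)
    (hφ : ∀ t, HasDerivAt φ (φ' t) t)
    (hg : ∀ t ∈ Ioo (0 : ℝ) 2, φ' t ^ 2 ≤ -w'' t / w t)
    {t : ℝ} (ht0 : 0 < t) (ht1 : t ≤ 1) :
    |φ t - φ 1| * w t ≤ 2 * w 1 * (1 - log t) := by
  have hwt : 0 < w t := hpos t ⟨ht0, by linarith⟩
  have key : ∀ s ∈ Icc t 1, w t * |φ' s| ≤ s * (-w'' s) + 2 * w 1 / s := by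
    intro s ⟨hs1, hs2⟩
    have hs0 : 0 < s := by linarith
    have hws : 0 < w s := hpos s ⟨hs0, by linarith⟩
    refine mul_abs_le_of_sq_le_div hwt.le hws hs0 ?_
      (hc.le_two_mul_of_nonneg h0 h2 hw ⟨hs0.le, by linarith⟩) (hg s ⟨hs0, by linarith⟩)
    have h2t : 0 < 2 - t := by linarith
    have := hc.2 (show t ∈ Icc 0 2 from ⟨ht0.le, by linarith⟩)
      (show (2 : ℝ) ∈ Icc 0 2 by norm_num)
      (show 0 ≤ (2 - s) / (2 - t) from div_nonneg (by linarith) h2t.le)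
      (show 0 ≤ (s - t) / (2 - t) from div_nonneg (by linarith) h2t.le)
      (by field_simp; ring)
    simp only [smul_eq_mul, h2, mul_zero, add_zero] at this
    rw [show (2 - s) / (2 - t) * t + (s - t) / (2 - t) * 2 = s by field_simp; ring] at this
    have h12 : 1 / 2 ≤ (2 - s) / (2 - t) := by
      rw [div_le_div_iff₀ (by norm_num) h2t]
      linarith
    nlinarith
  have hG : ∀ s ∈ Icc t 1, HasDerivAt (fun s => w s - s * w' s + 2 * w 1 * log s)
      (s * (-w'' s) + 2 * w 1 / s) s := by
    intro s hs
    have hs0 : s ≠ 0 := by linarith [hs.1]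
    have := ((hw s).sub ((hasDerivAt_id s).mul (hw' s))).add
      ((hasDerivAt_log hs0).const_mul (2 * w 1))
    refine this.congr_deriv ?_
    simp only [id]
    field_simp
    ring
  have mono : ∀ σ : ℝ, |σ| = 1 →
      MonotoneOn (fun s => (w s - s * w' s + 2 * w 1 * log s) + σ * w t * φ s) (Icc t 1) := by
    intro σ hσ
    have hd : ∀ s ∈ Icc t 1, HasDerivAt
        (fun s => (w s - s * w' s + 2 * w 1 * log s) + σ * w t * φ s)
        ((s * (-w'' s) + 2 * w 1 / s) + σ * w t * φ' s) s :=
      fun s hs => (hG s hs).add ((hφ s).const_mul _)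
    refine monotoneOn_of_deriv_nonneg (convex_Icc _ _)
      (fun s hs => (hd s hs).continuousAt.continuousWithinAt)
      (fun s hs => (hd s (interior_subset hs)).differentiableAt.differentiableWithinAt) ?_
    intro s hs
    have hs := interior_subset hs
    rw [(hd s hs).deriv]
    have h1 := key s hs
    have h2 : |σ * w t * φ' s| = w t * |φ' s| := by
      rw [abs_mul, abs_mul, hσ, abs_of_pos hwt, one_mul]
    linarith [neg_abs_le (σ * w t * φ' s)]
  have p := mono 1 (by simp) (left_mem_Icc.2 ht1) (right_mem_Icc.2 ht1) ht1
  have n := mono (-1) (by simp) (left_mem_Icc.2 ht1) (right_mem_Icc.2 ht1) ht1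
  simp only [log_one] at p n
  have a := hc.le_add_mul_of_hasDerivAt (x := 1) (y := 2) (by norm_num) (by norm_num) (hw 1)
  have b := hc.le_add_mul_of_hasDerivAt (x := t) (y := 0) ⟨ht0.le, by linarith⟩
    (by norm_num) (hw t)
  rw [h2] at a
  rw [h0] at b
  have e : |φ t - φ 1| * w t = |(φ t - φ 1) * w t| := by rw [abs_mul, abs_of_pos hwt]
  rw [e, abs_le]
  constructor <;> nlinarith

lemma two_sub_log_sub_log_nonneg {t : ℝ} (ht0 : 0 ≤ t) (ht2 : t ≤ 2) :
    0 ≤ 2 - log t - log (2 - t) := by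
  have h : ∀ x : ℝ, 0 ≤ x → x ≤ 2 → log x ≤ 1 := fun x h0 h2 => by
    rcases h0.eq_or_lt with rfl | h
    · simp
    · linarith [log_le_sub_one_of_pos h]
  linarith [h t ht0 ht2, h (2 - t) (by linarith) (by linarith)]

/-- If `φ'² ≤ -w''/w`, the oscillation of `φ` is controlled on all of `[0, 2]`. -/
lemma abs_sub_mul_le {w w' w'' φ φ' : ℝ → ℝ} (hc : ConcaveOn ℝ (Icc 0 2) w)
    (h0 : w 0 = 0) (h2 : w 2 = 0) (hpos : ∀ t ∈ Ioo (0 : ℝ) 2, 0 < w t)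
    (hw : ∀ t, HasDerivAt w (w' t) t) (hw' : ∀ t, HasDerivAt w' (w'' t) t)
    (hφ : ∀ t, HasDerivAt φ (φ' t) t)
    (hg : ∀ t ∈ Ioo (0 : ℝ) 2, φ' t ^ 2 ≤ -w'' t / w t)
    {t : ℝ} (ht : t ∈ Icc (0 : ℝ) 2) :
    |φ t - φ 1| * w t ≤ 2 * w 1 * (2 - log t - log (2 - t)) := by
  have h1 : 0 < w 1 := hpos 1 (by norm_num)
  have hlog : ∀ x : ℝ, 0 < x → x ≤ 2 → log x ≤ 1 := fun x h _ => by
    linarith [log_le_sub_one_of_pos h]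
  have hnn := two_sub_log_sub_log_nonneg ht.1 ht.2
  rcases ht.1.eq_or_lt with rfl | ht0
  · rw [h0, mul_zero]
    positivity
  rcases ht.2.eq_or_lt with rfl | ht2
  · rw [h2, mul_zero]
    positivity
  rcases le_total t 1 with h | h
  · refine (abs_sub_mul_le_of_le_one hc h0 h2 hpos hw hw' hφ hg ht0 h).trans ?_
    exact mul_le_mul_of_nonneg_left
      (by linarith [hlog (2 - t) (by linarith) (by linarith)]) (by positivity)
  · have hr : ∀ {g g' : ℝ → ℝ}, (∀ t, HasDerivAt g (g' t) t) →
        ∀ t, HasDerivAt (fun s => g (2 - s)) (-g' (2 - t)) t := fun hd t => by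
      simpa using (hd (2 - t)).comp_const_sub 2 t
    have hc' : ConcaveOn ℝ (Icc 0 2) (fun s => w (2 - s)) := by
      refine ⟨convex_Icc _ _, fun x hx y hy a b ha hb hab => ?_⟩
      have := hc.2 (show 2 - x ∈ Icc 0 2 from ⟨by linarith [hx.2], by linarith [hx.1]⟩)
        (show 2 - y ∈ Icc 0 2 from ⟨by linarith [hy.2], by linarith [hy.1]⟩) ha hb hab
      convert this using 2
      simp only [smul_eq_mul]
      linear_combination (-2) * hab
    have hw2 : ∀ t, HasDerivAt (fun s => -w' (2 - s)) (w'' (2 - t)) t := fun t => by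
      simpa using (hr hw' t).fun_neg
    have := abs_sub_mul_le_of_le_one (w := fun s => w (2 - s)) (φ := fun s => φ (2 - s)) hc'
      (by simpa using h2) (by simpa using h0)
      (fun s hs => hpos _ ⟨by linarith [hs.2], by linarith [hs.1]⟩) (hr hw) hw2 (hr hφ)
      (fun s hs => by
        simpa using hg (2 - s) ⟨by linarith [hs.2], by linarith [hs.1]⟩)
      (t := 2 - t) (by linarith) (by linarith)
    simp only [sub_sub_cancel, show (2 : ℝ) - 1 = 1 by norm_num] at this
    refine this.trans ?_
    exact mul_le_mul_of_nonneg_left (by linarith [hlog t ht0 ht2.le]) (by positivity)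

lemma intervalIntegrable_two_sub_log_sub_log :
    IntervalIntegrable (fun t : ℝ => 2 - log t - log (2 - t)) MeasureTheory.volume 0 2 := by
  have hl : IntervalIntegrable (fun t : ℝ => log (2 - t)) MeasureTheory.volume 0 2 := by
    simpa using (intervalIntegral.intervalIntegrable_log' (a := 2) (b := 0)).comp_sub_left 2
  exact (intervalIntegrable_const.sub intervalIntegral.intervalIntegrable_log').sub hl

lemma integral_two_sub_log_sub_log_le :
    ∫ t in (0 : ℝ)..2, (2 - log t - log (2 - t)) ≤ 8 := by
  have hl : IntervalIntegrable (fun t : ℝ => log (2 - t)) MeasureTheory.volume 0 2 := by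
    simpa using (intervalIntegral.intervalIntegrable_log' (a := 2) (b := 0)).comp_sub_left 2
  rw [intervalIntegral.integral_sub
      (intervalIntegrable_const.sub intervalIntegral.intervalIntegrable_log') hl,
    intervalIntegral.integral_sub intervalIntegrable_const
      intervalIntegral.intervalIntegrable_log',
    intervalIntegral.integral_comp_sub_left (fun t => log t)]
  simp only [intervalIntegral.integral_const, integral_log, sub_self, smul_eq_mul]
  norm_num
  linarith [log_pos (show (1 : ℝ) < 2 by norm_num)]

lemma integral_mul_two_sub : ∫ t in (0 : ℝ)..2, t * (2 - t) = 4 / 3 := by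
  have : ∀ t : ℝ, t * (2 - t) = 2 * t - t ^ 2 := fun t => by ring
  simp_rw [this]
  rw [intervalIntegral.integral_sub (Continuous.intervalIntegrable (by fun_prop) _ _)
    (Continuous.intervalIntegrable (by fun_prop) _ _), intervalIntegral.integral_const_mul,
    integral_id, integral_pow]
  norm_num


/-- For every `0 < ε < 1` there is a constant `C = C(ε) > 0`,
depending only on `ε` (not on `w` or `f`), such that: whenever `w : ℝ → ℝ` is
smooth, concave on `[0,2]`, with `w 0 = w 2 = 0`, `w' 0 = 1`, `w' 2 = −1`,
`w > 0` on `(0,2)`, and `f : ℝ → ℝ → ℝ` is smooth, `2π`-periodic in the second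
variable, satisfies the gradient inequality
`(∂_t f)² + w(t)⁻²·(∂_θ f)² ≤ −w''(t)/w(t)` on `(0,2) × ℝ` and the mean-zero
condition `∫₀^{2π} ∫₀² f(t,θ)·w(t) dt dθ = 0`, one has
`−C ≤ ∫₀^{2π} f(t₀,θ) dθ ≤ C` for every `t₀ ∈ [ε, 2−ε]`. -/
theorem angular_integral_bound_for_f (ε : ℝ) (hε0 : 0 < ε) (hε1 : ε < 1) :
    ∃ C : ℝ, 0 < C ∧
      ∀ (w : ℝ → ℝ) (f : ℝ → ℝ → ℝ),
        ContDiff ℝ (⊤ : ℕ∞) w →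
        ConcaveOn ℝ (Set.Icc 0 2) w →
        w 0 = 0 → w 2 = 0 →
        deriv w 0 = 1 → deriv w 2 = -1 →
        (∀ t ∈ Set.Ioo (0 : ℝ) 2, 0 < w t) →
        ContDiff ℝ (⊤ : ℕ∞) (Function.uncurry f) →
        (∀ t θ : ℝ, f t (θ + 2 * Real.pi) = f t θ) →
        (∀ t ∈ Set.Ioo (0 : ℝ) 2, ∀ θ : ℝ,
          (deriv (fun s => f s θ) t) ^ 2 + ((w t) ^ 2)⁻¹ * (deriv (fun s => f t s) θ) ^ 2
            ≤ -(deriv (deriv w) t) / w t) →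
        (∫ θ in (0 : ℝ)..(2 * Real.pi), ∫ t in (0 : ℝ)..2, f t θ * w t) = 0 →
        ∀ t₀ ∈ Set.Icc ε (2 - ε),
          -C ≤ (∫ θ in (0 : ℝ)..(2 * Real.pi), f t₀ θ) ∧
          (∫ θ in (0 : ℝ)..(2 * Real.pi), f t₀ θ) ≤ C := by
  have hL : 0 ≤ 1 - log ε := by linarith [log_neg hε0 hε1]
  refine ⟨48 * π + 2 * π * (8 * (1 - log ε) / ε), by positivity, ?_⟩
  intro w f hw hc h0 h2 _ _ hpos hf _ hg hmean t₀ ht₀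
  have hπ : (0 : ℝ) ≤ 2 * π := by positivity
  have h1 : 0 < w 1 := hpos 1 (by norm_num)
  have hw1 : ∀ t, HasDerivAt w (deriv w t) t := fun t =>
    (hw.differentiable (by simp) t).hasDerivAt
  have hw2 : ∀ t, HasDerivAt (deriv w) (deriv (deriv w) t) t := fun t =>
    ((contDiff_infty_iff_deriv.1 hw).2.differentiable (by simp) t).hasDerivAt
  have hfc : Continuous (Function.uncurry f) := hf.continuous
  have hft : ∀ θ, ContDiff ℝ (⊤ : ℕ∞) (fun s => f s θ) := fun θ =>
    hf.comp (contDiff_id.prodMk contDiff_const)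
  have hfθ : ∀ t, Continuous (fun θ => f t θ) := fun t =>
    hfc.comp (Continuous.prodMk_right t)
  have osc : ∀ θ, ∀ t ∈ Icc (0 : ℝ) 2,
      |f t θ - f 1 θ| * w t ≤ 2 * w 1 * (2 - log t - log (2 - t)) := fun θ t ht =>
    abs_sub_mul_le (φ := fun s => f s θ) hc h0 h2 hpos hw1 hw2
      (fun s => ((hft θ).differentiable (by simp) s).hasDerivAt)
      (fun s hs => le_trans (le_add_of_nonneg_right (by positivity)) (hg s hs θ)) ht
  have hwi : ∀ a b, IntervalIntegrable w MeasureTheory.volume a b := fun a b =>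
    hw.continuous.intervalIntegrable a b
  have hW : 2 / 3 * w 1 ≤ ∫ t in (0 : ℝ)..2, w t := by
    have : ∫ t in (0 : ℝ)..2, w 1 / 2 * (t * (2 - t)) ≤ ∫ t in (0 : ℝ)..2, w t :=
      intervalIntegral.integral_mono_on (by norm_num)
        (Continuous.intervalIntegrable (by fun_prop) _ _) (hwi _ _)
        (fun t ht => by linarith [hc.parabola_le h0 h2 h1 ht])
    rw [intervalIntegral.integral_const_mul, integral_mul_two_sub] at this
    linarith
  have slice : ∀ θ, |(∫ t in (0 : ℝ)..2, f t θ * w t) - f 1 θ * ∫ t in (0 : ℝ)..2, w t|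
      ≤ 16 * w 1 := by
    intro θ
    have hi : IntervalIntegrable (fun t => f t θ * w t) MeasureTheory.volume 0 2 :=
      ((hft θ).continuous.mul hw.continuous).intervalIntegrable _ _
    rw [← intervalIntegral.integral_const_mul, ← intervalIntegral.integral_sub
      hi ((hwi _ _).const_mul _)]
    have := intervalIntegral.norm_integral_le_of_norm_le (μ := MeasureTheory.volume)
      (f := fun t => f t θ * w t - f 1 θ * w t)
      (g := fun t => 2 * w 1 * (2 - log t - log (2 - t))) (zero_le_two (α := ℝ))
      (Filter.Eventually.of_forall fun t ht => by
        have hwt : 0 ≤ w t := by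
          have := hc.parabola_le h0 h2 h1 (Ioc_subset_Icc_self ht)
          have h3 : 0 ≤ w 1 * (t * (2 - t)) :=
            mul_nonneg h1.le (mul_nonneg ht.1.le (by linarith [ht.2]))
          linarith
        rw [← sub_mul, norm_mul, Real.norm_eq_abs, Real.norm_of_nonneg hwt]
        exact osc θ t (Ioc_subset_Icc_self ht))
      (intervalIntegrable_two_sub_log_sub_log.const_mul _)
    rw [intervalIntegral.integral_const_mul, Real.norm_eq_abs] at this
    refine this.trans ?_
    nlinarith [integral_two_sub_log_sub_log_le]
  have hcont : Continuous fun θ => ∫ t in (0 : ℝ)..2, f t θ * w t := by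
    refine intervalIntegral.continuous_parametric_intervalIntegral_of_continuous'
      (f := fun θ t => f t θ * w t) ?_ 0 2
    exact (hfc.comp continuous_swap).mul (hw.continuous.comp continuous_snd)
  have hF1 : |∫ θ in (0 : ℝ)..(2 * π), f 1 θ| ≤ 48 * π := by
    have := intervalIntegral.norm_integral_le_of_norm_le_const (a := 0) (b := 2 * π)
      (f := fun θ => (∫ t in (0 : ℝ)..2, f t θ * w t) - f 1 θ * ∫ t in (0 : ℝ)..2, w t)
      (fun θ _ => slice θ)
    rw [intervalIntegral.integral_sub (hcont.intervalIntegrable _ _)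
      (((hfθ 1).intervalIntegrable _ _).mul_const _), hmean,
      intervalIntegral.integral_mul_const, zero_sub, norm_neg, norm_mul, sub_zero,
      abs_of_nonneg hπ, Real.norm_eq_abs, Real.norm_eq_abs] at this
    have hW' := hW.trans (le_abs_self _)
    have h3 := (mul_le_mul_of_nonneg_left hW' (abs_nonneg (∫ θ in (0 : ℝ)..(2 * π), f 1 θ))).trans
      this
    by_contra! hlt
    nlinarith
  have hpt : ∀ θ, ‖f t₀ θ - f 1 θ‖ ≤ 8 * (1 - log ε) / ε := by
    intro θ
    have hm : t₀ ∈ Icc (0 : ℝ) 2 := ⟨by linarith [ht₀.1], by linarith [ht₀.2]⟩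
    have ho := osc θ t₀ hm
    have hl1 : log ε ≤ log t₀ := log_le_log hε0 ht₀.1
    have hl2 : log ε ≤ log (2 - t₀) := log_le_log hε0 (by linarith [ht₀.2])
    have hwl : w 1 * ε / 2 ≤ w t₀ := by
      refine le_trans ?_ (hc.parabola_le h0 h2 h1 hm)
      have : ε ≤ t₀ * (2 - t₀) := by nlinarith [ht₀.1, ht₀.2]
      gcongr
    rw [Real.norm_eq_abs, le_div_iff₀ hε0]
    have h3 := mul_le_mul_of_nonneg_left hwl (abs_nonneg (f t₀ θ - f 1 θ))
    have h4 : 2 * w 1 * (2 - log t₀ - log (2 - t₀)) ≤ 2 * w 1 * (2 * (1 - log ε)) := by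
      gcongr
      linarith
    refine le_of_mul_le_mul_left ?_ h1
    linarith
  have hdiff := intervalIntegral.norm_integral_le_of_norm_le_const (a := 0) (b := 2 * π)
    (f := fun θ => f t₀ θ - f 1 θ) (fun θ _ => hpt θ)
  rw [intervalIntegral.integral_sub ((hfθ t₀).intervalIntegrable _ _)
    ((hfθ 1).intervalIntegrable _ _), sub_zero, abs_of_nonneg hπ, Real.norm_eq_abs] at hdiff
  have hd := abs_le.1 hdiff
  have hF := abs_le.1 hF1
  constructor <;> linarith
end

section
/- For every θ ∈ ℝ, one has f(1, θ) ≤ 28 + 2√2·π. -/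
/-- If `φ'² w ≤ -w''` on `(0,1)` and `w` at most doubles when moving towards `0`, then the
`w`-weighted deviation of `φ` from `φ 1` is controlled by the mass of `w` and boundary data. -/
lemma weighted_deviation_le {w w₁ w₂ φ φ₁ : ℝ → ℝ}
    (hw : ∀ t, HasDerivAt w (w₁ t) t) (hw₁ : ∀ t, HasDerivAt w₁ (w₂ t) t)
    (hφ : ∀ t, HasDerivAt φ (φ₁ t) t) (h0 : w 0 = 0)
    (hnonneg : ∀ t ∈ Set.Icc (0 : ℝ) 1, 0 ≤ w t)
    (hdouble : ∀ s t, 0 ≤ t → t ≤ s → s ≤ 1 → w t ≤ 2 * w s)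
    (hgrad : ∀ t ∈ Set.Ioo (0 : ℝ) 1, φ₁ t ^ 2 * w t ≤ -w₂ t) :
    φ 1 * (∫ t in (0 : ℝ)..1, w t) - ∫ t in (0 : ℝ)..1, φ t * w t
      ≤ (∫ t in (0 : ℝ)..1, w t) + (w 1 - w₁ 1) / 2 := by
  have cw : Continuous w := continuous_iff_continuousAt.2 fun t => (hw t).continuousAt
  have cφ : Continuous φ := continuous_iff_continuousAt.2 fun t => (hφ t).continuousAt
  set V : ℝ → ℝ := fun x => ∫ t in (0 : ℝ)..x, w t with hV
  have dV : ∀ x, HasDerivAt V (w x) x := fun x => cw.integral_hasStrictDerivAt 0 x |>.hasDerivAt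
  have dU : ∀ x, HasDerivAt (fun x => ∫ t in (0 : ℝ)..x, φ t * w t) (φ x * w x) x := fun x =>
    (cφ.mul cw).integral_hasStrictDerivAt 0 x |>.hasDerivAt
  have hVle : ∀ x ∈ Set.Icc (0 : ℝ) 1, V x ≤ 2 * x * w x := by
    intro x hx
    have : V x ≤ ∫ _ in (0 : ℝ)..x, 2 * w x :=
      intervalIntegral.integral_mono_on hx.1 (cw.intervalIntegrable _ _)
        intervalIntegrable_const fun t ht => hdouble x t ht.1 ht.2 hx.2
    simp at this
    linarith
  have hVmono : ∀ x ∈ Set.Icc (0 : ℝ) 1, V x ≤ V 1 := by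
    intro x hx
    have h1 : V x + (∫ t in x..1, w t) = V 1 :=
      intervalIntegral.integral_add_adjacent_intervals (cw.intervalIntegrable _ _)
        (cw.intervalIntegrable _ _)
    have h2 : 0 ≤ ∫ t in x..1, w t := intervalIntegral.integral_nonneg hx.2 fun t ht =>
      hnonneg t ⟨hx.1.trans ht.1, ht.2⟩
    linarith
  have hV0 : ∀ x ∈ Set.Icc (0 : ℝ) 1, 0 ≤ V x := fun x hx =>
    intervalIntegral.integral_nonneg hx.1 fun t ht => hnonneg t ⟨ht.1, ht.2.trans hx.2⟩
  have dD : ∀ x, HasDerivAt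
      (fun x => V 1 * x + (w x - x * w₁ x) / 2 - (φ x * V x - ∫ t in (0 : ℝ)..x, φ t * w t))
      (V 1 + (-(x * w₂ x)) / 2 - φ₁ x * V x) x := by
    intro x
    refine ((((hasDerivAt_id' x).const_mul (V 1)).add
      (((hw x).sub ((hasDerivAt_id' x).mul (hw₁ x))).div_const 2)).sub
      (((hφ x).mul (dV x)).sub (dU x))).congr_deriv ?_
    ring
  have hmono := monotoneOn_of_deriv_nonneg (convex_Icc (0 : ℝ) 1)
    (fun x _ => (dD x).continuousAt.continuousWithinAt)
    (fun x _ => (dD x).differentiableAt.differentiableWithinAt) (by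
      intro x hx
      rw [interior_Icc] at hx
      have hx' : x ∈ Set.Icc (0 : ℝ) 1 := Set.Ioo_subset_Icc_self hx
      rw [(dD x).deriv]
      have h1 := mul_le_mul_of_nonneg_left (hgrad x hx) hx'.1
      have h2 := mul_le_mul_of_nonneg_right (hVle x hx') (sq_nonneg (φ₁ x))
      have h3 := mul_nonneg (hV0 x hx') (sq_nonneg (φ₁ x - 2))
      have h4 := hVmono x hx'
      nlinarith)
  have := hmono (Set.left_mem_Icc.2 zero_le_one) (Set.right_mem_Icc.2 zero_le_one) zero_le_one
  simp [h0, hV] at this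
  linarith

/-- A function whose derivative is dominated in absolute value by the derivative of `g` oscillates
at most as much as `g`. -/
lemma abs_sub_le_of_abs_deriv_le {φ φ₁ g g₁ : ℝ → ℝ} {a b : ℝ}
    (hφ : ∀ t, HasDerivAt φ (φ₁ t) t) (hg : ∀ t, HasDerivAt g (g₁ t) t)
    (hle : ∀ t ∈ Set.Icc a b, |φ₁ t| ≤ g₁ t) {x y : ℝ} (hx : x ∈ Set.Icc a b)
    (hy : y ∈ Set.Icc a b) : |φ x - φ y| ≤ g b - g a := by
  have mono : ∀ ψ ψ₁ : ℝ → ℝ, (∀ t, HasDerivAt ψ (ψ₁ t) t) → (∀ t ∈ Set.Icc a b, 0 ≤ ψ₁ t) →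
      MonotoneOn ψ (Set.Icc a b) := fun ψ ψ₁ h h' =>
    monotoneOn_of_deriv_nonneg (convex_Icc a b)
      (fun x _ => (h x).continuousAt.continuousWithinAt)
      (fun x _ => (h x).differentiableAt.differentiableWithinAt)
      (fun x hx => by rw [(h x).deriv]; exact h' x (interior_subset hx))
  have m1 := mono _ _ (fun t => (hg t).sub (hφ t)) fun t ht => by
    linarith [(abs_le.1 (hle t ht)).2]
  have m2 := mono _ _ (fun t => (hg t).add (hφ t)) fun t ht => by
    linarith [(abs_le.1 (hle t ht)).1]
  have m3 := mono _ _ hg fun t ht => (abs_nonneg _).trans (hle t ht)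
  have hab := hx.1.trans hx.2
  have la := Set.left_mem_Icc.2 hab
  have rb := Set.right_mem_Icc.2 hab
  have main : ∀ u v, u ∈ Set.Icc a b → v ∈ Set.Icc a b → u ≤ v → |φ u - φ v| ≤ g b - g a := by
    intro u v hu hv huv
    have a1 := m1 hu hv huv
    have a2 := m2 hu hv huv
    have a3 := m3 la hu hu.1
    have a4 := m3 hv rb hv.2
    simp only [Pi.sub_apply, Pi.add_apply] at a1 a2
    exact abs_le.2 ⟨by linarith, by linarith⟩
  rcases le_total x y with h | h
  · exact main x y hx hy h
  · rw [abs_sub_comm]; exact main y x hy hx h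

/-- A nonnegative concave function on `[0,2]` at most doubles when moving from a point of `[0,1]`
towards `0`. -/
lemma ConcaveOn.le_two_mul_of_le {w : ℝ → ℝ} (hconc : ConcaveOn ℝ (Set.Icc 0 2) w) (h2 : w 2 = 0)
    (hnonneg : ∀ t ∈ Set.Icc (0 : ℝ) 2, 0 ≤ w t) {s t : ℝ} (ht : 0 ≤ t) (hts : t ≤ s)
    (hs : s ≤ 1) : w t ≤ 2 * w s := by
  have hpos : 0 < 2 - t := by linarith
  have ha : 0 ≤ (2 - s) / (2 - t) := div_nonneg (by linarith) hpos.le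
  have hb : 0 ≤ (s - t) / (2 - t) := div_nonneg (by linarith) hpos.le
  have ht2 : t ∈ Set.Icc (0 : ℝ) 2 := ⟨ht, by linarith⟩
  have h := hconc.2 ht2 (Set.right_mem_Icc.2 zero_le_two) ha hb (by field_simp; ring)
  have e : ((2 - s) / (2 - t)) • t + ((s - t) / (2 - t)) • (2 : ℝ) = s := by
    simp only [smul_eq_mul]; field_simp; ring
  rw [e, h2] at h
  have hw := hnonneg t ⟨ht, by linarith⟩
  have hr : 1 / 2 ≤ (2 - s) / (2 - t) := by
    rw [div_le_div_iff₀ two_pos hpos]; linarith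
  simp only [smul_eq_mul, mul_zero, add_zero] at h
  nlinarith

/-- The graph of a concave function on `[0,2]` vanishing at `0` lies above its chord from `0` to
`1`. -/
lemma ConcaveOn.mul_apply_one_le {w : ℝ → ℝ} (hconc : ConcaveOn ℝ (Set.Icc 0 2) w) (h0 : w 0 = 0)
    {s : ℝ} (hs0 : 0 ≤ s) (hs : s ≤ 1) : s * w 1 ≤ w s := by
  have h1 : (1 : ℝ) ∈ Set.Icc (0 : ℝ) 2 := by norm_num
  have h := hconc.2 h1 (Set.left_mem_Icc.2 zero_le_two) hs0 (sub_nonneg.2 hs) (by ring)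
  simpa [h0] using h

/-- A concave function on `[0,2]` vanishing at `0` has mass at least `w 1 / 2` on `[0,1]`. -/
lemma ConcaveOn.half_apply_one_le_integral {w : ℝ → ℝ} (hconc : ConcaveOn ℝ (Set.Icc 0 2) w)
    (h0 : w 0 = 0) (hc : Continuous w) : w 1 / 2 ≤ ∫ t in (0 : ℝ)..1, w t := by
  have h : (∫ t in (0 : ℝ)..1, t * w 1) ≤ ∫ t in (0 : ℝ)..1, w t :=
    intervalIntegral.integral_mono_on zero_le_one
      (Continuous.intervalIntegrable (by fun_prop) _ _) (hc.intervalIntegrable _ _)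
      fun t ht => hconc.mul_apply_one_le h0 ht.1 ht.2
  rw [intervalIntegral.integral_mul_const, integral_id] at h
  linarith

/-- Concavity on `[0,2]` is preserved by the reflection `t ↦ 2 - t`. -/
lemma ConcaveOn.comp_two_sub {w : ℝ → ℝ} (hconc : ConcaveOn ℝ (Set.Icc 0 2) w) :
    ConcaveOn ℝ (Set.Icc 0 2) fun t => w (2 - t) := by
  refine ⟨convex_Icc _ _, fun x hx y hy a b ha hb hab => ?_⟩
  have hx' : 2 - x ∈ Set.Icc (0 : ℝ) 2 := ⟨by linarith [hx.2], by linarith [hx.1]⟩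
  have hy' : 2 - y ∈ Set.Icc (0 : ℝ) 2 := ⟨by linarith [hy.2], by linarith [hy.1]⟩
  have h := hconc.2 hx' hy' ha hb hab
  have e : a • (2 - x) + b • (2 - y) = 2 - (a • x + b • y) := by
    simp only [smul_eq_mul]; linear_combination 2 * hab
  rwa [e] at h

/-- Under the hypotheses on `w` and `f` (smoothness, concavity,
boundary conditions, positivity of `w` on `(0,2)`, periodicity, gradient
inequality, and mean-zero condition), one has `f(1,θ) ≤ 28 + 2√2·π` for all `θ`. -/
theorem pointwise_upper_bound_at_one (w : ℝ → ℝ) (f : ℝ → ℝ → ℝ)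
    (hw : ContDiff ℝ (⊤ : ℕ∞) w)
    (hconc : ConcaveOn ℝ (Set.Icc 0 2) w)
    (h0 : w 0 = 0) (h2 : w 2 = 0)
    (hd0 : deriv w 0 = 1) (hd2 : deriv w 2 = -1)
    (hwpos : ∀ t ∈ Set.Ioo (0 : ℝ) 2, 0 < w t)
    (hf : ContDiff ℝ (⊤ : ℕ∞) (Function.uncurry f))
    (hper : ∀ t θ : ℝ, f t (θ + 2 * Real.pi) = f t θ)
    (hgrad : ∀ t ∈ Set.Ioo (0 : ℝ) 2, ∀ θ : ℝ,
      (deriv (fun s => f s θ) t) ^ 2 + ((w t) ^ 2)⁻¹ * (deriv (fun s => f t s) θ) ^ 2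
        ≤ -(deriv (deriv w) t) / w t)
    (hmean : (∫ θ in (0 : ℝ)..(2 * Real.pi), ∫ t in (0 : ℝ)..2, f t θ * w t) = 0) :
    ∀ θ : ℝ, f 1 θ ≤ 28 + 2 * Real.sqrt 2 * Real.pi := by
  have hdw : ∀ t, HasDerivAt w (deriv w t) t := fun t =>
    (hw.differentiable (by simp) t).hasDerivAt
  have hw₁ : ContDiff ℝ (⊤ : ℕ∞) (deriv w) := (contDiff_infty_iff_deriv.1 hw).2
  have hdw₁ : ∀ t, HasDerivAt (deriv w) (deriv (deriv w) t) t := fun t =>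
    (hw₁.differentiable (by simp) t).hasDerivAt
  have cw : Continuous w := hw.continuous
  have hft : ∀ θ t, HasDerivAt (fun s => f s θ) (deriv (fun s => f s θ) t) t := fun θ t => by
    have : ContDiff ℝ (⊤ : ℕ∞) (fun s => f s θ) := hf.comp (contDiff_id.prodMk contDiff_const)
    exact (this.differentiable (by simp) t).hasDerivAt
  have hfθ : ∀ t, Differentiable ℝ (fun s => f t s) := fun t => by
    have : ContDiff ℝ (⊤ : ℕ∞) (fun s => f t s) := hf.comp (contDiff_const.prodMk contDiff_id)
    exact this.differentiable (by simp)
  have hnonneg : ∀ t ∈ Set.Icc (0 : ℝ) 2, 0 ≤ w t := by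
    intro t ht
    rcases ht.1.eq_or_lt with h | h
    · rw [← h, h0]
    rcases ht.2.eq_or_lt with h' | h'
    · rw [h', h2]
    · exact (hwpos t ⟨h, h'⟩).le
  have hgt : ∀ θ, ∀ t ∈ Set.Ioo (0 : ℝ) 2,
      (deriv (fun s => f s θ) t) ^ 2 * w t ≤ -deriv (deriv w) t := by
    intro θ t ht
    rw [← le_div_iff₀ (hwpos t ht)]
    have := hgrad t ht θ
    have : 0 ≤ ((w t) ^ 2)⁻¹ * (deriv (fun s => f t s) θ) ^ 2 := by positivity
    linarith
  have hgθ : ∀ θ, ∀ t ∈ Set.Ioo (0 : ℝ) 2,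
      (deriv (fun s => f t s) θ) ^ 2 ≤ w t * -deriv (deriv w) t := by
    intro θ t ht
    have hp := hwpos t ht
    have h1 : ((w t) ^ 2)⁻¹ * (deriv (fun s => f t s) θ) ^ 2 ≤ -(deriv (deriv w) t) / w t := by
      linarith [hgrad t ht θ, sq_nonneg (deriv (fun s => f s θ) t)]
    have h3 := mul_le_mul_of_nonneg_left h1 (sq_nonneg (w t))
    field_simp at h3
    linarith
  have hdouble : ∀ s t, 0 ≤ t → t ≤ s → s ≤ 1 → w t ≤ 2 * w s := fun s t =>
    hconc.le_two_mul_of_le h2 hnonneg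
  have hrconc := hconc.comp_two_sub
  have hrnonneg : ∀ t ∈ Set.Icc (0 : ℝ) 2, 0 ≤ w (2 - t) := fun t ht =>
    hnonneg _ ⟨by linarith [ht.2], by linarith [ht.1]⟩
  have hrdouble : ∀ s t, 0 ≤ t → t ≤ s → s ≤ 1 → w (2 - t) ≤ 2 * w (2 - s) := fun s t =>
    hrconc.le_two_mul_of_le (by simpa using h0) hrnonneg
  have hw1 : 0 < w 1 := hwpos 1 (by norm_num)
  have hlow : ∀ t ∈ Set.Icc (1 / 2 : ℝ) (3 / 2), w 1 ≤ 2 * w t := by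
    intro t ht
    rcases le_total t 1 with h | h
    · have := hconc.mul_apply_one_le h0 (by linarith [ht.1]) h
      nlinarith [ht.1]
    · have := hrconc.mul_apply_one_le (by simpa using h2) (s := 2 - t)
        (by linarith [ht.2]) (by linarith)
      norm_num at this
      nlinarith [ht.2]
  have hw2nonneg : ∀ t ∈ Set.Ioo (0 : ℝ) 2, 0 ≤ -deriv (deriv w) t := fun t ht =>
    (mul_nonneg (sq_nonneg _) (hwpos t ht).le).trans (hgt 0 t ht)
  have hanti : AntitoneOn (deriv w) (Set.Icc 0 2) := by
    refine antitoneOn_of_deriv_nonpos (convex_Icc _ _) hw₁.continuous.continuousOn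
      (fun x _ => (hdw₁ x).differentiableAt.differentiableWithinAt) fun x hx => ?_
    rw [interior_Icc] at hx
    linarith [hw2nonneg x hx]
  have mem0 : (0 : ℝ) ∈ Set.Icc (0 : ℝ) 2 := by norm_num
  have mem2 : (2 : ℝ) ∈ Set.Icc (0 : ℝ) 2 := by norm_num
  have hle1 : ∀ t ∈ Set.Ioo (0 : ℝ) 2, w t ≤ 1 := by
    intro t ht
    have ht' := Set.Ioo_subset_Icc_self ht
    have a := hconc.slope_le_of_hasDerivAt mem0 ht' ht.1 (hdw 0)
    have b := hconc.le_slope_of_hasDerivAt ht' mem2 ht.2 (hdw 2)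
    rw [slope_def_field, h0, hd0, div_le_iff₀ (by linarith [ht.1])] at a
    rw [slope_def_field, h2, hd2, le_div_iff₀ (by linarith [ht.2])] at b
    linarith
  have hdl : deriv w (1 / 2) ≤ 4 * w 1 := by
    have a := hconc.le_slope_of_hasDerivAt mem0 (y := 1 / 2) (by norm_num) (by norm_num) (hdw _)
    rw [slope_def_field, h0, le_div_iff₀ (by norm_num)] at a
    linarith [hdouble 1 (1 / 2) (by norm_num) (by norm_num) le_rfl]
  have hdr : -(4 * w 1) ≤ deriv w (3 / 2) := by
    have a := hconc.slope_le_of_hasDerivAt (x := 3 / 2) (by norm_num) mem2 (by norm_num) (hdw _)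
    rw [slope_def_field, h2, div_le_iff₀ (by norm_num)] at a
    have := hrdouble 1 (1 / 2) (by norm_num) (by norm_num) le_rfl
    norm_num at this
    linarith
  -- Oscillation of `f` along meridians near the equator `t = 1`.
  have hosc : ∀ θ, ∀ s ∈ Set.Icc (1 / 2 : ℝ) (3 / 2), |f s θ - f 1 θ| ≤ 5 := by
    intro θ s hs
    have hg : ∀ t, HasDerivAt (fun t => t - deriv w t / (2 * w 1))
        (1 - deriv (deriv w) t / (2 * w 1)) t := fun t =>
      (hasDerivAt_id' t).sub ((hdw₁ t).div_const _)
    have key := abs_sub_le_of_abs_deriv_le (hft θ) hg (a := 1 / 2) (b := 3 / 2) (by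
      intro t ht
      have ht' : t ∈ Set.Ioo (0 : ℝ) 2 := ⟨by linarith [ht.1], by linarith [ht.2]⟩
      have h1 := hgt θ t ht'
      have h2 := hlow t ht
      set p := deriv (fun s => f s θ) t
      have h3 : p ^ 2 / 4 ≤ -deriv (deriv w) t / (2 * w 1) := by
        rw [div_le_div_iff₀ (by norm_num) (by linarith)]
        nlinarith [sq_nonneg p]
      rw [neg_div] at h3
      refine abs_le.2 ⟨?_, ?_⟩ <;> nlinarith [sq_nonneg (p - 2), sq_nonneg (p + 2)])
      hs (y := 1) (by norm_num)
    have h3 : (deriv w (1 / 2) - deriv w (3 / 2)) / (2 * w 1) ≤ 4 := by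
      rw [div_le_iff₀ (by linarith)]; linarith
    rw [sub_div] at h3
    refine key.trans ?_
    linarith
  -- A parallel near the equator along which `f` oscillates little.
  obtain ⟨s, hs, hs2⟩ := exists_deriv_eq_slope (deriv w) (show (1 / 2 : ℝ) < 3 / 2 by norm_num)
    hw₁.continuous.continuousOn (fun x _ => (hdw₁ x).differentiableAt.differentiableWithinAt)
  have hs' : s ∈ Set.Ioo (0 : ℝ) 2 := ⟨by linarith [hs.1], by linarith [hs.2]⟩
  have hs2le : -deriv (deriv w) s ≤ 2 := by
    have a := hanti mem0 (show (1 / 2 : ℝ) ∈ Set.Icc (0 : ℝ) 2 by norm_num) (by norm_num)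
    have b := hanti (show (3 / 2 : ℝ) ∈ Set.Icc (0 : ℝ) 2 by norm_num) mem2 (by norm_num)
    norm_num at hs2 a b
    linarith
  have hpar : ∀ θ ∈ Set.Icc 0 (2 * Real.pi), ∀ η ∈ Set.Icc 0 (2 * Real.pi),
      f s θ - f s η ≤ 2 * Real.sqrt 2 * Real.pi := by
    intro θ hθ η hη
    have h := Convex.norm_image_sub_le_of_norm_deriv_le (f := fun u => f s u) (C := Real.sqrt 2)
      (s := Set.univ) (fun u _ => hfθ s u) (fun u _ => by
        rw [Real.norm_eq_abs]
        refine Real.abs_le_sqrt ((hgθ u s hs').trans ?_)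
        nlinarith [hle1 s hs', hw2nonneg s hs'])
      convex_univ (Set.mem_univ η) (Set.mem_univ θ)
    rw [Real.norm_eq_abs, Real.norm_eq_abs] at h
    have h5 : |θ - η| ≤ 2 * Real.pi :=
      abs_le.2 ⟨by linarith [hθ.1, hη.2], by linarith [hθ.2, hη.1]⟩
    have h6 := mul_le_mul_of_nonneg_left h5 (Real.sqrt_nonneg 2)
    linarith [le_abs_self (f s θ - f s η)]
  -- A meridian along which the weighted mean of `f` is nonpositive.
  obtain ⟨θ₁, hθ₁, hF⟩ : ∃ θ₁ ∈ Set.Icc 0 (2 * Real.pi),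
      (∫ t in (0 : ℝ)..2, f t θ₁ * w t) ≤ 0 := by
    by_contra! hcon
    have cF : Continuous fun θ => ∫ t in (0 : ℝ)..2, f t θ * w t := by
      refine intervalIntegral.continuous_parametric_intervalIntegral_of_continuous' ?_ 0 2
      exact (hf.continuous.comp continuous_swap).mul (cw.comp continuous_snd)
    have := intervalIntegral.intervalIntegral_pos_of_pos_on
      (cF.intervalIntegrable 0 (2 * Real.pi))
      (fun θ hθ => hcon θ (Set.Ioo_subset_Icc_self hθ)) Real.two_pi_pos
    exact this.ne' hmean
  have hθ₁le : f 1 θ₁ ≤ 2 := by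
    have cf : Continuous fun t => f t θ₁ :=
      continuous_iff_continuousAt.2 fun t => (hft θ₁ t).continuousAt
    have A := weighted_deviation_le hdw hdw₁ (hft θ₁) h0
      (fun t ht => hnonneg t ⟨ht.1, by linarith [ht.2]⟩) hdouble
      (fun t ht => hgt θ₁ t ⟨ht.1, by linarith [ht.2]⟩)
    have hrefl : ∀ {g g' : ℝ → ℝ}, (∀ t, HasDerivAt g (g' t) t) →
        ∀ t, HasDerivAt (fun t => g (2 - t)) (-g' (2 - t)) t := fun {g g'} hg t => by
      simpa using (hg (2 - t)).comp_const_sub 2 t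
    have B := weighted_deviation_le (hrefl hdw) (fun t => (hrefl hdw₁ t).neg) (hrefl (hft θ₁))
      (by simpa using h2) (fun t ht => hrnonneg t ⟨ht.1, by linarith [ht.2]⟩) hrdouble
      (fun t ht => by
        have := hgt θ₁ (2 - t) ⟨by linarith [ht.2], by linarith [ht.1]⟩
        simpa using this)
    have I1 := hconc.half_apply_one_le_integral h0 cw
    have I2 := hrconc.half_apply_one_le_integral (by simpa using h2) (by fun_prop)
    rw [intervalIntegral.integral_comp_sub_left (fun t => w t),
      intervalIntegral.integral_comp_sub_left (fun t => f t θ₁ * w t)] at B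
    rw [intervalIntegral.integral_comp_sub_left (fun t => w t)] at I2
    have e1 := intervalIntegral.integral_add_adjacent_intervals (μ := MeasureTheory.volume)
      ((cf.mul cw).intervalIntegrable 0 1) ((cf.mul cw).intervalIntegrable 1 2)
    simp only [Pi.mul_apply] at e1
    norm_num at A B I1 I2 e1
    set J₁ := ∫ t in (0 : ℝ)..1, w t
    set J₂ := ∫ t in (1 : ℝ)..2, w t
    by_contra! hcon
    nlinarith
  intro θ
  obtain ⟨θ₀, hθ₀, he⟩ :=
    (show Function.Periodic (f 1) (2 * Real.pi) from hper 1).exists_mem_Ico₀ Real.two_pi_pos θ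
  rw [he]
  have hsI := Set.Ioo_subset_Icc_self hs
  have a := abs_le.1 (hosc θ₀ s hsI)
  have b := abs_le.1 (hosc θ₁ s hsI)
  have c := hpar θ₀ (Set.Ico_subset_Icc_self hθ₀) θ₁ hθ₁
  linarith [a.1, b.2]
end

section
/- For every t ∈ (0,1] and every θ ∈ ℝ, one has the weighted pointwise bound e^{2·f(t,θ)}·w(t) ≤ e⁴ · e^{2·f(1,θ)} · w(1) · t^{−5/8}. -/
/-- If `φ'² ≤ -w''/w` on `[t, 1]`, then
`s ↦ 2φ + log w + (5/8) log s - 2s w'/w` is larger at `1` than at `t`. -/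
theorem le_of_weighted_gradient_bound {w w' w'' φ φ' : ℝ → ℝ} {t : ℝ} (ht0 : 0 < t) (ht1 : t ≤ 1)
    (hpos : ∀ s ∈ Set.Icc t 1, 0 < w s)
    (hw : ∀ s ∈ Set.Icc t 1, HasDerivAt w (w' s) s)
    (hw' : ∀ s ∈ Set.Icc t 1, HasDerivAt w' (w'' s) s)
    (hφ : ∀ s ∈ Set.Icc t 1, HasDerivAt φ (φ' s) s)
    (hbound : ∀ s ∈ Set.Icc t 1, φ' s ^ 2 ≤ -w'' s / w s) :
    2 * φ t + Real.log (w t) + 5 / 8 * Real.log t - 2 * (t * (w' t / w t)) ≤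
      2 * φ 1 + Real.log (w 1) - 2 * (w' 1 / w 1) := by
  have hderiv : ∀ s ∈ Set.Icc t 1, HasDerivAt
      (fun s => 2 * φ s + Real.log (w s) + 5 / 8 * Real.log s - 2 * (s * (w' s / w s)))
      (2 * φ' s + w' s / w s + 5 / 8 * s⁻¹ -
        2 * (1 * (w' s / w s) + s * ((w'' s * w s - w' s * w' s) / w s ^ 2))) s := by
    intro s hs
    have hs0 : s ≠ 0 := (ht0.trans_le hs.1).ne'
    have hws := (hpos s hs).ne'
    exact ((((hφ s hs).const_mul 2).add ((hw s hs).log hws)).add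
      ((Real.hasDerivAt_log hs0).const_mul (5 / 8))).sub
      (((hasDerivAt_id s).mul ((hw' s hs).div (hw s hs) hws)).const_mul 2)
  have hmono := monotoneOn_of_hasDerivWithinAt_nonneg (convex_Icc t 1)
    (fun s hs => (hderiv s hs).continuousAt.continuousWithinAt)
    (fun s hs => (hderiv s (interior_subset hs)).hasDerivWithinAt)
    (fun s hs => by
      have hs := interior_subset hs
      have hs0 : 0 < s := ht0.trans_le hs.1
      have hws := (hpos s hs).ne'
      have hquot : (w'' s * w s - w' s * w' s) / w s ^ 2 =
          -(-w'' s / w s) - (w' s / w s) ^ 2 := by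
        field_simp
      rw [hquot]
      have hmul := mul_le_mul_of_nonneg_left (hbound s hs) hs0.le
      have hsq : 2 * φ' s - w' s / w s + 5 / 8 * s⁻¹ + 2 * s * (φ' s ^ 2 + (w' s / w s) ^ 2) =
          2 * s * (φ' s + s⁻¹ / 2) ^ 2 + 2 * s * (w' s / w s - s⁻¹ / 4) ^ 2 := by
        generalize w' s / w s = u
        field_simp
        ring
      have hnn : 0 ≤ 2 * s * (φ' s + s⁻¹ / 2) ^ 2 + 2 * s * (w' s / w s - s⁻¹ / 4) ^ 2 := by
        positivity
      linarith)
  have h := hmono (Set.left_mem_Icc.2 ht1) (Set.right_mem_Icc.2 ht1) ht1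
  simpa using h

/-- Under the hypotheses on `w` and `f` (smoothness, concavity,
boundary conditions, positivity of `w` on `(0,2)`, periodicity, gradient
inequality), for every `t ∈ (0,1]` and every `θ`,
`e^{2f(t,θ)}·w(t) ≤ e⁴·e^{2f(1,θ)}·w(1)·t^{−5/8}`. -/
theorem weighted_pointwise_bound (w : ℝ → ℝ) (f : ℝ → ℝ → ℝ)
    (hw : ContDiff ℝ (⊤ : ℕ∞) w)
    (hconc : ConcaveOn ℝ (Set.Icc 0 2) w)
    (h0 : w 0 = 0) (h2 : w 2 = 0)
    (hd0 : deriv w 0 = 1) (hd2 : deriv w 2 = -1)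
    (hwpos : ∀ t ∈ Set.Ioo (0 : ℝ) 2, 0 < w t)
    (hf : ContDiff ℝ (⊤ : ℕ∞) (Function.uncurry f))
    (hper : ∀ t θ : ℝ, f t (θ + 2 * Real.pi) = f t θ)
    (hgrad : ∀ t ∈ Set.Ioo (0 : ℝ) 2, ∀ θ : ℝ,
      (deriv (fun s => f s θ) t) ^ 2 + ((w t) ^ 2)⁻¹ * (deriv (fun s => f t s) θ) ^ 2
        ≤ -(deriv (deriv w) t) / w t) :
    ∀ t ∈ Set.Ioc (0 : ℝ) 1, ∀ θ : ℝ,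
      Real.exp (2 * f t θ) * w t ≤
        Real.exp 4 * Real.exp (2 * f 1 θ) * w 1 * t ^ (-(5 : ℝ) / 8) := by
  intro t ht θ
  obtain ⟨ht0, ht1⟩ := ht
  have hwd : ∀ s, HasDerivAt w (deriv w s) s := fun s =>
    (hw.differentiable (by simp) s).hasDerivAt
  have hw' : ContDiff ℝ (⊤ : ℕ∞) (deriv w) := (contDiff_infty_iff_deriv.1 hw).2
  have hwdd : ∀ s, HasDerivAt (deriv w) (deriv (deriv w) s) s := fun s =>
    (hw'.differentiable (by simp) s).hasDerivAt
  have hfd : ∀ s, HasDerivAt (fun s => f s θ) (deriv (fun s => f s θ) s) s := by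
    have h : ContDiff ℝ (⊤ : ℕ∞) (fun s => f s θ) :=
      hf.comp (contDiff_id.prodMk contDiff_const)
    exact fun s => (h.differentiable (by simp) s).hasDerivAt
  have hwt : 0 < w t := hwpos t ⟨ht0, by linarith⟩
  have hw1 : 0 < w 1 := hwpos 1 ⟨by norm_num, by norm_num⟩
  have hleft : t * (deriv w t / w t) ≤ 1 := by
    have h := hconc.le_slope_of_hasDerivAt (x := 0) (y := t) ⟨le_rfl, by norm_num⟩
      ⟨ht0.le, by linarith⟩ ht0 (hwd t)
    rw [slope_def_field, h0, sub_zero, sub_zero, le_div_iff₀ ht0] at h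
    rw [mul_div_assoc', div_le_one hwt]
    linarith
  have hright : -1 ≤ deriv w 1 / w 1 := by
    have h := hconc.slope_le_of_hasDerivAt (x := 1) (y := 2) ⟨by norm_num, by norm_num⟩
      ⟨by norm_num, le_rfl⟩ (by norm_num) (hwd 1)
    rw [slope_def_field, h2] at h
    rw [le_div_iff₀ hw1]
    linarith
  have hmono := le_of_weighted_gradient_bound ht0 ht1
    (fun s hs => hwpos s ⟨ht0.trans_le hs.1, by linarith [hs.2]⟩)
    (fun s _ => hwd s) (fun s _ => hwdd s) (fun s _ => hfd s)
    (fun s hs => by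
      have hs' : s ∈ Set.Ioo (0 : ℝ) 2 := ⟨ht0.trans_le hs.1, by linarith [hs.2]⟩
      have hnn : 0 ≤ ((w s) ^ 2)⁻¹ * (deriv (fun r => f s r) θ) ^ 2 := by positivity
      linarith [hgrad s hs' θ])
  rw [Real.rpow_def_of_pos ht0, ← Real.exp_log hwt, ← Real.exp_log hw1]
  simp only [← Real.exp_add, Real.exp_le_exp]
  linarith
end

section
/- The weighted integral of e^{2f} satisfies ∫₀^{2π} ∫₀² e^{2·f(t,θ)}·w(t) dt dθ ≤ 400·π·e^{100}·w(1). -/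
/-- A differentiable concave function lies below its tangent lines. -/
lemma ConcaveOn.le_tangent {s : Set ℝ} {w : ℝ → ℝ} (hc : ConcaveOn ℝ s w) {x y w' : ℝ}
    (hx : x ∈ s) (hy : y ∈ s) (hd : HasDerivAt w w' x) : w y ≤ w x + w' * (y - x) := by
  rcases lt_trichotomy x y with h | rfl | h
  · have := hc.slope_le_of_hasDerivAt hx hy h hd
    rw [slope_def_field, div_le_iff₀ (sub_pos.2 h)] at this
    linarith
  · simp
  · have := hc.le_slope_of_hasDerivAt hy hx h hd
    rw [slope_def_field, le_div_iff₀ (sub_pos.2 h)] at this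
    linarith

/-- The Riccati-type comparison behind all pointwise bounds: if `g'² ≤ -w''/w` on `(0,1]`, then
`2 g + β log w + κ log t - 2 t w'/w` is monotone as soon as `(2 - β)² ≤ 8 (κ - 1/2)`. -/
lemma two_mul_add_log_le {w w₁ w₂ g g₁ : ℝ → ℝ} {β κ : ℝ} (hβκ : (2 - β) ^ 2 ≤ 8 * (κ - 1 / 2))
    (hw : ∀ t ∈ Set.Ioc (0 : ℝ) 1, HasDerivAt w (w₁ t) t)
    (hw₁ : ∀ t ∈ Set.Ioc (0 : ℝ) 1, HasDerivAt w₁ (w₂ t) t)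
    (hg : ∀ t ∈ Set.Ioc (0 : ℝ) 1, HasDerivAt g (g₁ t) t)
    (hpos : ∀ t ∈ Set.Ioc (0 : ℝ) 1, 0 < w t)
    (hle : ∀ t ∈ Set.Ioc (0 : ℝ) 1, t * w₁ t ≤ w t)
    (hone : -w 1 ≤ w₁ 1)
    (hgrad : ∀ t ∈ Set.Ioc (0 : ℝ) 1, g₁ t ^ 2 ≤ -w₂ t / w t)
    {a : ℝ} (ha : a ∈ Set.Ioc (0 : ℝ) 1) :
    2 * g a + β * Real.log (w a) + κ * Real.log a ≤ 2 * g 1 + β * Real.log (w 1) + 4 := by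
  have hder : ∀ t ∈ Set.Ioc (0 : ℝ) 1, HasDerivAt
      (fun t => 2 * g t + β * Real.log (w t) + κ * Real.log t - 2 * (t * (w₁ t / w t)))
      (2 * g₁ t + β * (w₁ t / w t) + κ * t⁻¹
        - 2 * (1 * (w₁ t / w t) + t * ((w₂ t * w t - w₁ t * w₁ t) / w t ^ 2))) t := by
    intro t ht
    have hw0 := (hpos t ht).ne'
    exact ((((hg t ht).const_mul 2).add (((hw t ht).log hw0).const_mul β)).add
      ((Real.hasDerivAt_log ht.1.ne').const_mul κ)).sub
      (((hasDerivAt_id t).mul ((hw₁ t ht).div (hw t ht) hw0)).const_mul 2)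
  have hmono : MonotoneOn
      (fun t => 2 * g t + β * Real.log (w t) + κ * Real.log t - 2 * (t * (w₁ t / w t)))
      (Set.Ioc 0 1) := by
    refine monotoneOn_of_deriv_nonneg (convex_Ioc 0 1)
      (fun t ht => (hder t ht).continuousAt.continuousWithinAt) ?_ ?_
    · intro t ht
      exact (hder t (interior_subset ht)).differentiableAt.differentiableWithinAt
    · intro t ht
      have ht' := interior_subset ht
      rw [(hder t ht').deriv]
      have ht0 : 0 < t := ht'.1
      have hw0 := hpos t ht'
      have hq := hgrad t ht'
      set q := -w₂ t / w t with hqdef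
      set u := w₁ t / w t with hudef
      have e : (w₂ t * w t - w₁ t * w₁ t) / w t ^ 2 = -q - u ^ 2 := by
        rw [hqdef, hudef]; field_simp
      rw [e]
      have key : 0 ≤ t * (2 * g₁ t + β * u + κ * t⁻¹ - 2 * (1 * u + t * (-q - u ^ 2))) := by
        have : t * (2 * g₁ t + β * u + κ * t⁻¹ - 2 * (1 * u + t * (-q - u ^ 2)))
            = 2 * (t * g₁ t) + (β - 2) * (t * u) + κ + 2 * t ^ 2 * q + 2 * (t * u) ^ 2 := by
          field_simp; ring
        rw [this]
        have h1 : 2 * (t * g₁ t) ^ 2 ≤ 2 * t ^ 2 * q := by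
          have := mul_le_mul_of_nonneg_left hq (by positivity : 0 ≤ 2 * t ^ 2)
          linarith [this, mul_pow t (g₁ t) 2]
        nlinarith [sq_nonneg (2 * (t * g₁ t) + 1), sq_nonneg (4 * (t * u) + (β - 2))]
      exact nonneg_of_mul_nonneg_right key ht0
  have h1 : (1 : ℝ) ∈ Set.Ioc (0 : ℝ) 1 := ⟨one_pos, le_rfl⟩
  have hm := hmono ha h1 ha.2
  have hu1 : -1 ≤ w₁ 1 / w 1 := by
    rw [le_div_iff₀ (hpos 1 h1)]; linarith
  have hua : a * (w₁ a / w a) ≤ 1 := by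
    rw [← mul_div_assoc, div_le_one (hpos a ha)]; exact hle a ha
  simp only [Real.log_one] at hm
  linarith

lemma neg_log_le_rpow {t : ℝ} (ht : 0 < t) : -Real.log t ≤ 8 / 5 * t ^ (-(5 / 8) : ℝ) := by
  have h := Real.log_le_rpow_div (inv_nonneg.2 ht.le) (show (0 : ℝ) < 5 / 8 by norm_num)
  rw [Real.log_inv, Real.inv_rpow ht.le, ← Real.rpow_neg ht.le] at h
  linarith

/-- Bounds on `(0,1]` under the half-sphere hypotheses of `two_mul_add_log_le`. -/
lemma half_bounds {w w₁ w₂ g g₁ : ℝ → ℝ}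
    (hw : ∀ t ∈ Set.Ioc (0 : ℝ) 1, HasDerivAt w (w₁ t) t)
    (hw₁ : ∀ t ∈ Set.Ioc (0 : ℝ) 1, HasDerivAt w₁ (w₂ t) t)
    (hg : ∀ t ∈ Set.Ioc (0 : ℝ) 1, HasDerivAt g (g₁ t) t)
    (hpos : ∀ t ∈ Set.Ioc (0 : ℝ) 1, 0 < w t)
    (hle : ∀ t ∈ Set.Ioc (0 : ℝ) 1, t * w₁ t ≤ w t)
    (hone : -w 1 ≤ w₁ 1)
    (hgrad : ∀ t ∈ Set.Ioc (0 : ℝ) 1, g₁ t ^ 2 ≤ -w₂ t / w t)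
    {a : ℝ} (ha : a ∈ Set.Ioc (0 : ℝ) 1) :
    Real.exp (2 * g a) * w a ≤ Real.exp 4 * w 1 * Real.exp (2 * g 1) * a ^ (-(5 / 8) : ℝ) ∧
    |g a - g 1| ≤ 2 + 4 / 5 * a ^ (-(5 / 8) : ℝ) := by
  have hwa := hpos a ha
  have hw1 := hpos 1 ⟨one_pos, le_rfl⟩
  constructor
  · have h := two_mul_add_log_le (β := 1) (κ := 5 / 8) (by norm_num) hw hw₁ hg hpos hle hone
      hgrad ha
    rw [Real.rpow_def_of_pos ha.1, ← Real.exp_log hwa, ← Real.exp_log hw1, ← Real.exp_add,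
      ← Real.exp_add, ← Real.exp_add, ← Real.exp_add]
    apply Real.exp_le_exp.2
    linarith
  · have h₁ := two_mul_add_log_le (β := 0) (κ := 1) (by norm_num) hw hw₁ hg hpos hle hone
      hgrad ha
    have h₂ := two_mul_add_log_le (β := 0) (κ := 1) (g := fun t => -g t) (g₁ := fun t => -g₁ t)
      (by norm_num) hw hw₁ (fun t ht => (hg t ht).neg) hpos hle hone
      (fun t ht => by simpa using hgrad t ht) ha
    have h₃ := neg_log_le_rpow ha.1
    rw [abs_le]
    constructor <;> linarith

/-- Integrable weight, singular at both poles of `[0,2]`. -/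
noncomputable def poleWeight (t : ℝ) : ℝ := t ^ (-(5 / 8) : ℝ) + (2 - t) ^ (-(5 / 8) : ℝ)

lemma intervalIntegrable_poleWeight :
    IntervalIntegrable poleWeight MeasureTheory.volume 0 2 := by
  have h : IntervalIntegrable (fun t : ℝ => t ^ (-(5 / 8) : ℝ)) MeasureTheory.volume 0 2 :=
    intervalIntegral.intervalIntegrable_rpow' (by norm_num)
  have h' := (h.comp_sub_left 2).symm
  norm_num only at h'
  exact h.add h'

lemma integral_poleWeight_le : ∫ t in (0 : ℝ)..2, poleWeight t ≤ 32 / 3 := by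
  have h : IntervalIntegrable (fun t : ℝ => t ^ (-(5 / 8) : ℝ)) MeasureTheory.volume 0 2 :=
    intervalIntegral.intervalIntegrable_rpow' (by norm_num)
  have h' := (h.comp_sub_left 2).symm
  norm_num only at h'
  unfold poleWeight
  have e : ∫ t in (0 : ℝ)..2, (2 - t) ^ (-(5 / 8) : ℝ) = ∫ t in (0 : ℝ)..2, t ^ (-(5 / 8) : ℝ) := by
    rw [intervalIntegral.integral_comp_sub_left (fun t : ℝ => t ^ (-(5 / 8) : ℝ)) 2]
    norm_num
  rw [intervalIntegral.integral_add h h', e, integral_rpow (Or.inl (by norm_num)),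
    Real.zero_rpow (by norm_num)]
  have : (2 : ℝ) ^ (-(5 / 8) + 1 : ℝ) ≤ 2 ^ (1 : ℝ) :=
    Real.rpow_le_rpow_of_exponent_le (by norm_num) (by norm_num)
  rw [Real.rpow_one] at this
  rw [sub_zero, ← add_div, div_le_iff₀ (by norm_num)]
  linarith

/-- Bounds for a fixed angle along a full meridian. -/
lemma meridian_bounds {w g : ℝ → ℝ} (hw : ContDiff ℝ (⊤ : ℕ∞) w)
    (hconc : ConcaveOn ℝ (Set.Icc 0 2) w) (h0 : w 0 = 0) (h2 : w 2 = 0)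
    (hwpos : ∀ t ∈ Set.Ioo (0 : ℝ) 2, 0 < w t) (hg : Differentiable ℝ g)
    (hgrad : ∀ t ∈ Set.Ioo (0 : ℝ) 2, deriv g t ^ 2 ≤ -(deriv (deriv w) t) / w t)
    {t : ℝ} (ht : t ∈ Set.Ioo (0 : ℝ) 2) :
    Real.exp (2 * g t) * w t ≤ Real.exp 4 * w 1 * Real.exp (2 * g 1) * poleWeight t ∧
    |g t - g 1| ≤ 2 + 4 / 5 * poleWeight t := by
  have hd : ∀ x, HasDerivAt w (deriv w x) x := fun x =>
    ((hw.differentiable (by simp)) x).hasDerivAt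
  have hd' : ∀ x, HasDerivAt (deriv w) (deriv (deriv w) x) x := fun x =>
    ((((contDiff_infty_iff_deriv.1 hw).2).differentiable (by simp)) x).hasDerivAt
  have m0 : (0 : ℝ) ∈ Set.Icc (0 : ℝ) 2 := by norm_num
  have m1 : (1 : ℝ) ∈ Set.Icc (0 : ℝ) 2 := by norm_num
  have m2 : (2 : ℝ) ∈ Set.Icc (0 : ℝ) 2 := by norm_num
  have hw1 := hwpos 1 (by norm_num)
  have hp : 0 ≤ t ^ (-(5 / 8) : ℝ) := Real.rpow_nonneg ht.1.le _
  have hp' : 0 ≤ (2 - t) ^ (-(5 / 8) : ℝ) := Real.rpow_nonneg (by linarith [ht.2]) _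
  have hc : 0 ≤ Real.exp 4 * w 1 * Real.exp (2 * g 1) := by positivity
  rcases le_total t 1 with h | h
  · have hb := half_bounds (w := w) (w₁ := deriv w) (w₂ := deriv (deriv w)) (g := g)
      (g₁ := deriv g) (fun t _ => hd t) (fun t _ => hd' t) (fun t _ => (hg t).hasDerivAt)
      (fun t ht => hwpos t ⟨ht.1, by linarith [ht.2]⟩)
      (fun t ht => by
        have := hconc.le_tangent (x := t) ⟨ht.1.le, by linarith [ht.2]⟩ m0 (hd t)
        rw [h0] at this; linarith)
      (by have := hconc.le_tangent m1 m2 (hd 1)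
          rw [h2] at this; linarith)
      (fun t ht => hgrad t ⟨ht.1, by linarith [ht.2]⟩) ⟨ht.1, h⟩
    unfold poleWeight
    refine ⟨hb.1.trans (mul_le_mul_of_nonneg_left (by linarith) hc), hb.2.trans (by linarith)⟩
  · have hb := half_bounds (w := fun x => w (2 - x)) (w₁ := fun x => -deriv w (2 - x))
      (w₂ := fun x => deriv (deriv w) (2 - x)) (g := fun x => g (2 - x))
      (g₁ := fun x => -deriv g (2 - x)) (a := 2 - t)
      (fun t _ => (hd (2 - t)).comp_const_sub 2 t)
      (fun t _ => (((hd' (2 - t)).comp_const_sub 2 t).neg).congr_deriv (neg_neg _))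
      (fun t _ => (hg (2 - t)).hasDerivAt.comp_const_sub 2 t)
      (fun t ht => hwpos (2 - t) ⟨by linarith [ht.2], by linarith [ht.1]⟩)
      (fun t ht => by
        have := hconc.le_tangent (x := 2 - t) ⟨by linarith [ht.2], by linarith [ht.1]⟩ m2
          (hd (2 - t))
        rw [h2] at this; linarith)
      (by have := hconc.le_tangent m1 m0 (hd 1)
          rw [h0] at this; norm_num; linarith)
      (fun t ht => by
        simpa using hgrad (2 - t) ⟨by linarith [ht.2], by linarith [ht.1]⟩)
      ⟨by linarith [ht.2], by linarith⟩
    norm_num only [sub_sub_cancel] at hb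
    unfold poleWeight
    refine ⟨hb.1.trans (mul_le_mul_of_nonneg_left (by linarith) hc), hb.2.trans (by linarith)⟩

/-- Where `-w'' ≤ 2` and `w ≤ 1`, the function `f` oscillates by at most `9` on a parallel. -/
lemma parallel_oscillation_le {g : ℝ → ℝ} {v k : ℝ} (hg : Differentiable ℝ g) (hv : 0 < v)
    (hv1 : v ≤ 1) (hk : k ≤ 2) (hgrad : ∀ θ, (v ^ 2)⁻¹ * deriv g θ ^ 2 ≤ k / v)
    {θ₁ θ₂ : ℝ} (h₁ : θ₁ ∈ Set.Icc 0 (2 * Real.pi)) (h₂ : θ₂ ∈ Set.Icc 0 (2 * Real.pi)) :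
    |g θ₁ - g θ₂| ≤ 9 := by
  have hb : ∀ θ ∈ (Set.univ : Set ℝ), ‖deriv g θ‖ ≤ 1.42 := by
    intro θ _
    have h := hgrad θ
    have h' : deriv g θ ^ 2 ≤ k * v := by
      have := mul_le_mul_of_nonneg_left h (sq_nonneg v)
      field_simp at this
      nlinarith
    rw [Real.norm_eq_abs]
    refine abs_le_of_sq_le_sq ?_ (by norm_num)
    nlinarith
  have := convex_univ.norm_image_sub_le_of_norm_deriv_le (fun x _ => hg x) hb
    (Set.mem_univ θ₂) (Set.mem_univ θ₁)
  rw [Real.norm_eq_abs, Real.norm_eq_abs] at this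
  have h3 : |θ₁ - θ₂| ≤ 2 * Real.pi := by
    rw [abs_le]; constructor <;> linarith [h₁.1, h₁.2, h₂.1, h₂.2]
  have := Real.pi_lt_d2
  linarith

/-- A concave profile on `[0,2]` with unit slopes at its zeros is nearly flat and below height `1`
at some parallel between `1/2` and `3/2`. -/
lemma exists_flat_parallel {w : ℝ → ℝ} (hw : ContDiff ℝ (⊤ : ℕ∞) w)
    (hconc : ConcaveOn ℝ (Set.Icc 0 2) w) (h0 : w 0 = 0) (h2 : w 2 = 0)
    (hd0 : deriv w 0 = 1) (hd2 : deriv w 2 = -1) :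
    ∃ t ∈ Set.Ioo (1 / 2 : ℝ) (3 / 2), w t ≤ 1 ∧ -deriv (deriv w) t ≤ 2 := by
  have hd : ∀ x, HasDerivAt w (deriv w x) x := fun x =>
    ((hw.differentiable (by simp)) x).hasDerivAt
  have hd' : Differentiable ℝ (deriv w) :=
    ((contDiff_infty_iff_deriv.1 hw).2).differentiable (by simp)
  have m0 : (0 : ℝ) ∈ Set.Icc (0 : ℝ) 2 := by norm_num
  have m2 : (2 : ℝ) ∈ Set.Icc (0 : ℝ) 2 := by norm_num
  have ml : (1 / 2 : ℝ) ∈ Set.Icc (0 : ℝ) 2 := by norm_num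
  have mr : (3 / 2 : ℝ) ∈ Set.Icc (0 : ℝ) 2 := by norm_num
  have hup : ∀ x ∈ Set.Icc (0 : ℝ) 2, w x ≤ x ∧ w x ≤ 2 - x := fun x hx => by
    have a := hconc.le_tangent m0 hx (hd 0)
    have b := hconc.le_tangent m2 hx (hd 2)
    rw [h0, hd0] at a
    rw [h2, hd2] at b
    constructor <;> linarith
  obtain ⟨t, ht, he⟩ := exists_deriv_eq_slope (deriv w) (show (1 / 2 : ℝ) < 3 / 2 by norm_num)
    hd'.continuous.continuousOn hd'.differentiableOn
  refine ⟨t, ht, ?_, ?_⟩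
  · have := hup t ⟨by linarith [ht.1], by linarith [ht.2]⟩
    linarith [this.1, this.2]
  · have a := hconc.le_tangent ml m0 (hd _)
    have b := hconc.le_tangent mr m2 (hd _)
    have c := (hup _ ml).1
    have d := (hup _ mr).2
    norm_num only at he
    rw [h0] at a
    rw [h2] at b
    rw [he]
    norm_num
    linarith

/-- A concave profile on `[0,2]` vanishing at both ends is comparable to its value at `1`. -/
lemma concave_profile_bounds {w : ℝ → ℝ} (hw : Differentiable ℝ w)
    (hconc : ConcaveOn ℝ (Set.Icc 0 2) w) (h0 : w 0 = 0) (h2 : w 2 = 0) (h1 : 0 ≤ w 1)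
    {t : ℝ} (ht : t ∈ Set.Icc (0 : ℝ) 2) :
    w 1 * (t * (2 - t) / 2) ≤ w t ∧ w t ≤ 2 * w 1 := by
  have hd : ∀ x, HasDerivAt w (deriv w x) x := fun x => (hw x).hasDerivAt
  have m0 : (0 : ℝ) ∈ Set.Icc (0 : ℝ) 2 := by norm_num
  have m1 : (1 : ℝ) ∈ Set.Icc (0 : ℝ) 2 := by norm_num
  have m2 : (2 : ℝ) ∈ Set.Icc (0 : ℝ) 2 := by norm_num
  obtain ⟨ht0, ht2⟩ := ht
  constructor
  · have a := hconc.le_tangent ⟨ht0, ht2⟩ m0 (hd t)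
    have b := hconc.le_tangent ⟨ht0, ht2⟩ m1 (hd t)
    have c := hconc.le_tangent ⟨ht0, ht2⟩ m2 (hd t)
    rw [h0] at a
    rw [h2] at c
    rcases le_total t 1 with h | h
    · have h' : t * w 1 ≤ w t := by
        linarith [mul_le_mul_of_nonneg_left a (sub_nonneg.2 h), mul_le_mul_of_nonneg_left b ht0]
      nlinarith [mul_nonneg h1 (mul_nonneg ht0 ht0)]
    · have h' : (2 - t) * w 1 ≤ w t := by
        linarith [mul_le_mul_of_nonneg_left c (sub_nonneg.2 h),
          mul_le_mul_of_nonneg_left b (sub_nonneg.2 ht2)]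
      nlinarith [mul_nonneg h1 (mul_nonneg (sub_nonneg.2 ht2) (sub_nonneg.2 ht2))]
  · have a := hconc.le_tangent m1 m0 (hd 1)
    have b := hconc.le_tangent m1 m2 (hd 1)
    have c := hconc.le_tangent m1 ⟨ht0, ht2⟩ (hd 1)
    rw [h0] at a
    rw [h2] at b
    nlinarith [mul_nonneg ht0 (sub_nonneg.2 ht2)]

/-- If `A - (4/5) poleWeight ≤ F` along a meridian with `128/5 ≤ A`, then `∫ F w` is bounded below
by `(2/3) (A - 128/5) w 1`. -/
lemma le_integral_mul_profile {w F : ℝ → ℝ} {A : ℝ} (hA : 128 / 5 ≤ A) (hw : Differentiable ℝ w)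
    (hconc : ConcaveOn ℝ (Set.Icc 0 2) w) (h0 : w 0 = 0) (h2 : w 2 = 0) (h1 : 0 ≤ w 1)
    (hF : Continuous F) (hle : ∀ t ∈ Set.Ioo (0 : ℝ) 2, A - 4 / 5 * poleWeight t ≤ F t) :
    w 1 * (2 / 3 * (A - 128 / 5)) ≤ ∫ t in (0 : ℝ)..2, F t * w t := by
  have hp : IntervalIntegrable (fun t : ℝ => A * w 1 * (t * (2 - t) / 2))
      MeasureTheory.volume 0 2 := (by fun_prop : Continuous _).intervalIntegrable _ _
  have hψ : IntervalIntegrable (fun t => 8 / 5 * w 1 * poleWeight t)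
      MeasureTheory.volume 0 2 := intervalIntegrable_poleWeight.const_mul _
  have hmono : ∫ t in (0 : ℝ)..2, (A * w 1 * (t * (2 - t) / 2) - 8 / 5 * w 1 * poleWeight t)
      ≤ ∫ t in (0 : ℝ)..2, F t * w t := by
    refine intervalIntegral.integral_mono_on_of_le_Ioo (by norm_num) (hp.sub hψ)
      ((hF.mul hw.continuous).intervalIntegrable _ _) fun t ht => ?_
    have hb := concave_profile_bounds hw hconc h0 h2 h1 ⟨ht.1.le, ht.2.le⟩
    have hψ0 : 0 ≤ poleWeight t := add_nonneg (Real.rpow_nonneg ht.1.le _)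
      (Real.rpow_nonneg (sub_nonneg.2 ht.2.le) _)
    have hwt : 0 ≤ w t := le_trans (mul_nonneg h1 (div_nonneg (mul_nonneg ht.1.le
      (sub_nonneg.2 ht.2.le)) zero_le_two)) hb.1
    have e1 := mul_le_mul_of_nonneg_right (hle t ht) hwt
    have e2 := mul_le_mul_of_nonneg_left hb.1 (show 0 ≤ A by linarith)
    have e3 := mul_le_mul_of_nonneg_left hb.2 hψ0
    linarith
  rw [intervalIntegral.integral_sub hp hψ, intervalIntegral.integral_const_mul,
    intervalIntegral.integral_const_mul] at hmono
  have hpoly : ∫ t in (0 : ℝ)..2, t * (2 - t) / 2 = 2 / 3 := by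
    have : ∀ t : ℝ, t * (2 - t) / 2 = t - t ^ 2 / 2 := fun t => by ring
    simp_rw [this]
    rw [intervalIntegral.integral_sub ((by fun_prop : Continuous _).intervalIntegrable _ _)
      ((by fun_prop : Continuous _).intervalIntegrable _ _), integral_id,
      intervalIntegral.integral_div, integral_pow]
    norm_num
  rw [hpoly] at hmono
  have := mul_le_mul_of_nonneg_left integral_poleWeight_le h1
  linarith

/-- Under the hypotheses on `w` and `f` (smoothness, concavity,
boundary conditions, positivity of `w` on `(0,2)`, periodicity, gradient
inequality, and mean-zero condition), the weighted integral of `e^{2f}` satisfies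
`∫₀^{2π} ∫₀² e^{2f(t,θ)}·w(t) dt dθ ≤ 400·π·e^{100}·w(1)`. -/
theorem weighted_integral_exp_two_f_bound (w : ℝ → ℝ) (f : ℝ → ℝ → ℝ)
    (hw : ContDiff ℝ (⊤ : ℕ∞) w)
    (hconc : ConcaveOn ℝ (Set.Icc 0 2) w)
    (h0 : w 0 = 0) (h2 : w 2 = 0)
    (hd0 : deriv w 0 = 1) (hd2 : deriv w 2 = -1)
    (hwpos : ∀ t ∈ Set.Ioo (0 : ℝ) 2, 0 < w t)
    (hf : ContDiff ℝ (⊤ : ℕ∞) (Function.uncurry f))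
    (hper : ∀ t θ : ℝ, f t (θ + 2 * Real.pi) = f t θ)
    (hgrad : ∀ t ∈ Set.Ioo (0 : ℝ) 2, ∀ θ : ℝ,
      (deriv (fun s => f s θ) t) ^ 2 + ((w t) ^ 2)⁻¹ * (deriv (fun s => f t s) θ) ^ 2
        ≤ -(deriv (deriv w) t) / w t)
    (hmean : (∫ θ in (0 : ℝ)..(2 * Real.pi), ∫ t in (0 : ℝ)..2, f t θ * w t) = 0) :
    (∫ θ in (0 : ℝ)..(2 * Real.pi), ∫ t in (0 : ℝ)..2, Real.exp (2 * f t θ) * w t)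
      ≤ 400 * Real.pi * Real.exp 100 * w 1 := by
  have hwd : Differentiable ℝ w := hw.differentiable (by simp)
  have hfc : Continuous (Function.uncurry f) := hf.continuous
  have hf1 : ∀ θ, Differentiable ℝ (fun t => f t θ) := fun θ =>
    (hf.differentiable (by simp)).comp (differentiable_id.prodMk (differentiable_const θ))
  have hf2 : ∀ t, Differentiable ℝ (fun θ => f t θ) := fun t =>
    (hf.differentiable (by simp)).comp ((differentiable_const t).prodMk differentiable_id)
  have hpi : (0 : ℝ) ≤ 2 * Real.pi := by positivity
  have hw1 : 0 < w 1 := hwpos 1 (by norm_num)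
  have hmer : ∀ θ, ∀ t ∈ Set.Ioo (0 : ℝ) 2,
      Real.exp (2 * f t θ) * w t ≤ Real.exp 4 * w 1 * Real.exp (2 * f 1 θ) * poleWeight t ∧
      |f t θ - f 1 θ| ≤ 2 + 4 / 5 * poleWeight t := fun θ t ht =>
    meridian_bounds (g := fun s => f s θ) hw hconc h0 h2 hwpos (hf1 θ)
      (fun s hs => le_trans (le_add_of_nonneg_right (by positivity)) (hgrad s hs θ)) ht
  obtain ⟨t₀, ht₀, hwt₀, hk⟩ := exists_flat_parallel hw hconc h0 h2 hd0 hd2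
  have ht₀' : t₀ ∈ Set.Ioo (0 : ℝ) 2 := ⟨by linarith [ht₀.1], by linarith [ht₀.2]⟩
  have hosc : ∀ θ₁ ∈ Set.Icc 0 (2 * Real.pi), ∀ θ₂ ∈ Set.Icc 0 (2 * Real.pi),
      |f t₀ θ₁ - f t₀ θ₂| ≤ 9 := fun θ₁ h₁ θ₂ h₂ =>
    parallel_oscillation_le (hf2 t₀) (hwpos t₀ ht₀') hwt₀ hk
      (fun θ => le_trans (le_add_of_nonneg_left (sq_nonneg _)) (hgrad t₀ ht₀' θ)) h₁ h₂
  have hψt₀ : poleWeight t₀ ≤ 4 := by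
    have key : ∀ s : ℝ, 1 / 2 < s → s ^ (-(5 / 8) : ℝ) ≤ 2 := fun s hs => by
      calc s ^ (-(5 / 8) : ℝ) ≤ (1 / 2 : ℝ) ^ (-(5 / 8) : ℝ) :=
            Real.rpow_le_rpow_of_nonpos (by norm_num) hs.le (by norm_num)
        _ ≤ (1 / 2 : ℝ) ^ (-1 : ℝ) :=
            Real.rpow_le_rpow_of_exponent_ge (by norm_num) (by norm_num) (by norm_num)
        _ = 2 := by rw [Real.rpow_neg_one]; norm_num
    have a := key t₀ ht₀.1
    have b := key (2 - t₀) (by linarith [ht₀.2])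
    unfold poleWeight
    linarith
  have hequator : ∀ θ₀ ∈ Set.Icc 0 (2 * Real.pi), f 1 θ₀ ≤ 47 := by
    intro θ₀ hθ₀
    by_contra! hlt
    have hinner : ∀ θ ∈ Set.Icc 0 (2 * Real.pi),
        w 1 * (2 / 3 * (f 1 θ₀ - 107 / 5 - 128 / 5)) ≤ ∫ t in (0 : ℝ)..2, f t θ * w t := by
      intro θ hθ
      refine le_integral_mul_profile (F := fun t => f t θ) (by linarith) hwd hconc h0 h2 hw1.le
        (hf1 θ).continuous fun t ht => ?_
      have a := abs_le.1 (hmer θ t ht).2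
      have b := abs_le.1 (hmer θ t₀ ht₀').2
      have c := abs_le.1 (hmer θ₀ t₀ ht₀').2
      have d := abs_le.1 (hosc θ hθ θ₀ hθ₀)
      linarith [a.1, b.2, c.1, d.1]
    have hcont : Continuous fun θ => ∫ t in (0 : ℝ)..2, f t θ * w t := by
      apply intervalIntegral.continuous_parametric_intervalIntegral_of_continuous'
      exact (hfc.comp continuous_swap).mul (hwd.continuous.comp continuous_snd)
    have hm := intervalIntegral.integral_mono_on (μ := MeasureTheory.volume) hpi
      intervalIntegrable_const (hcont.intervalIntegrable _ _) hinner
    rw [hmean, intervalIntegral.integral_const, smul_eq_mul, sub_zero] at hm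
    have : 0 < 2 * Real.pi * (w 1 * (2 / 3 * (f 1 θ₀ - 107 / 5 - 128 / 5))) :=
      mul_pos (by positivity) (mul_pos hw1 (by linarith))
    linarith
  have hinner : ∀ θ ∈ Set.Icc 0 (2 * Real.pi),
      ∫ t in (0 : ℝ)..2, Real.exp (2 * f t θ) * w t ≤ Real.exp 98 * w 1 * (32 / 3) := by
    intro θ hθ
    have hcθ : Continuous fun t => Real.exp (2 * f t θ) * w t :=
      (Real.continuous_exp.comp ((hf1 θ).continuous.const_mul 2)).mul hwd.continuous
    have hm := intervalIntegral.integral_mono_on_of_le_Ioo (zero_le_two (α := ℝ))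
      (hcθ.intervalIntegrable _ _)
      (intervalIntegrable_poleWeight.const_mul (Real.exp 4 * w 1 * Real.exp (2 * f 1 θ)))
      fun t ht => (hmer θ t ht).1
    rw [intervalIntegral.integral_const_mul] at hm
    have hexp : Real.exp 4 * w 1 * Real.exp (2 * f 1 θ) ≤ Real.exp 98 * w 1 := by
      rw [mul_right_comm, ← Real.exp_add]
      exact mul_le_mul_of_nonneg_right (Real.exp_le_exp.2 (by linarith [hequator θ hθ])) hw1.le
    calc _ ≤ _ := hm
      _ ≤ Real.exp 4 * w 1 * Real.exp (2 * f 1 θ) * (32 / 3) :=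
          mul_le_mul_of_nonneg_left integral_poleWeight_le (by positivity)
      _ ≤ _ := mul_le_mul_of_nonneg_right hexp (by norm_num)
  have hcont : Continuous fun θ => ∫ t in (0 : ℝ)..2, Real.exp (2 * f t θ) * w t := by
    apply intervalIntegral.continuous_parametric_intervalIntegral_of_continuous'
    exact (Real.continuous_exp.comp ((hfc.comp continuous_swap).const_mul 2)).mul
      (hwd.continuous.comp continuous_snd)
  have hm := intervalIntegral.integral_mono_on (μ := MeasureTheory.volume) hpi
    (hcont.intervalIntegrable _ _) intervalIntegrable_const hinner
  rw [intervalIntegral.integral_const, smul_eq_mul, sub_zero] at hm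
  have hexp : Real.exp 98 ≤ Real.exp 100 := Real.exp_le_exp.2 (by norm_num)
  calc _ ≤ _ := hm
    _ = 64 / 3 * Real.pi * Real.exp 98 * w 1 := by ring
    _ ≤ 400 * Real.pi * Real.exp 100 * w 1 := by gcongr; norm_num
end

section
/- Let 0 < ε < 1 and c > 0. Let u : ℝ → ℝ be twice continuously differentiable on [0,2] with u'' ≤ 0 and |u'| ≤ 1 on [0,2], and with u(r) ≥ c for all r ∈ [ε, 2−ε]. Let g : ℝ → ℝ be differentiable on [ε, 2−ε] with g'(r)² ≤ −u''(r)/u(r) for all r ∈ [ε, 2−ε]. Then for all r₁, r₂ with ε ≤ r₁ ≤ r₂ ≤ 2−ε, |g(r₂) − g(r₁)| ≤ √(2·(r₂ − r₁)/c). -/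
/-- Radial Hölder-1/2 estimate. Let `0 < ε < 1`, `c > 0`.
Let `u` be twice continuously differentiable on `[0,2]` with `u'' ≤ 0` and
`|u'| ≤ 1` there, and `u ≥ c` on `[ε, 2−ε]`. Let `g` be differentiable on
`[ε, 2−ε]` with `g'(r)² ≤ −u''(r)/u(r)` there. Then for `ε ≤ r₁ ≤ r₂ ≤ 2−ε`,
`|g(r₂) − g(r₁)| ≤ √(2(r₂ − r₁)/c)`. -/
theorem radial_holder_half_estimate (ε c : ℝ) (hε0 : 0 < ε) (hε1 : ε < 1) (hc : 0 < c)
    (u u' u'' g g' : ℝ → ℝ)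
    (hu' : ∀ r ∈ Set.Icc (0 : ℝ) 2, HasDerivAt u (u' r) r)
    (hu'' : ∀ r ∈ Set.Icc (0 : ℝ) 2, HasDerivAt u' (u'' r) r)
    (hu''cont : ContinuousOn u'' (Set.Icc (0 : ℝ) 2))
    (hconc : ∀ r ∈ Set.Icc (0 : ℝ) 2, u'' r ≤ 0)
    (hlip : ∀ r ∈ Set.Icc (0 : ℝ) 2, |u' r| ≤ 1)
    (hlow : ∀ r ∈ Set.Icc ε (2 - ε), c ≤ u r)
    (hg : ∀ r ∈ Set.Icc ε (2 - ε), HasDerivAt g (g' r) r)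
    (hgrad : ∀ r ∈ Set.Icc ε (2 - ε), (g' r) ^ 2 ≤ -(u'' r) / u r) :
    ∀ r₁ r₂ : ℝ, ε ≤ r₁ → r₁ ≤ r₂ → r₂ ≤ 2 - ε →
      |g r₂ - g r₁| ≤ Real.sqrt (2 * (r₂ - r₁) / c) := by
  intro r₁ r₂ h₁ h₁₂ h₂
  rcases h₁₂.eq_or_lt with rfl | hlt
  · simp
  set K := Real.sqrt (2 * (r₂ - r₁) / c) with hK
  have hpos : 0 < 2 * (r₂ - r₁) / c := div_pos (by linarith) hc
  have hKpos : 0 < K := Real.sqrt_pos.2 hpos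
  have hcK : 0 < c * K := mul_pos hc hKpos
  have hKsq : c * K ^ 2 = 2 * (r₂ - r₁) := by
    rw [hK, Real.sq_sqrt hpos.le]
    field_simp
  have hsub : ∀ r ∈ Set.Icc r₁ r₂, r ∈ Set.Icc ε (2 - ε) :=
    fun r hr => ⟨h₁.trans hr.1, hr.2.trans h₂⟩
  have hsub' : ∀ r ∈ Set.Icc r₁ r₂, r ∈ Set.Icc (0 : ℝ) 2 :=
    fun r hr => ⟨by linarith [hr.1], by linarith [hr.2]⟩
  have hm₁ : r₁ ∈ Set.Icc r₁ r₂ := Set.left_mem_Icc.2 h₁₂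
  have hm₂ : r₂ ∈ Set.Icc r₁ r₂ := Set.right_mem_Icc.2 h₁₂
  -- Integrated form of Young's inequality with the optimal weight, for `g` and `-g` at once.
  have key : ∀ s : ℝ, s ^ 2 = 1 → s * (g r₂ - g r₁) ≤ K := by
    intro s hs
    have hF : ∀ r ∈ Set.Icc r₁ r₂, HasDerivAt (fun x => s * g x + K / 4 * u' x - x / (c * K))
        (s * g' r + K / 4 * u'' r - 1 / (c * K)) r := fun r hr =>
      (((hg r (hsub r hr)).const_mul s).add ((hu'' r (hsub' r hr)).const_mul (K / 4))).sub
        ((hasDerivAt_id r).div_const (c * K))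
    have hF_nonpos : ∀ r ∈ Set.Icc r₁ r₂, s * g' r + K / 4 * u'' r - 1 / (c * K) ≤ 0 := by
      intro r hr
      have hur := hlow r (hsub r hr)
      have hgr := (le_div_iff₀ (hc.trans_le hur)).1 (hgrad r (hsub r hr))
      have hbound : c * g' r ^ 2 ≤ -u'' r := by nlinarith [sq_nonneg (g' r)]
      have hsquare : s * g' r - K / 4 * (c * g' r ^ 2) - 1 / (c * K)
          = -(1 - s * (c * K) * g' r / 2) ^ 2 / (c * K) := by
        field_simp
        linear_combination (4 * c ^ 2 * K ^ 2 * g' r ^ 2) * hs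
      have hsquare_nonpos : -(1 - s * (c * K) * g' r / 2) ^ 2 / (c * K) ≤ 0 :=
        div_nonpos_of_nonpos_of_nonneg (neg_nonpos.2 (sq_nonneg _)) hcK.le
      nlinarith
    have hanti : AntitoneOn (fun x => s * g x + K / 4 * u' x - x / (c * K)) (Set.Icc r₁ r₂) :=
      antitoneOn_of_hasDerivWithinAt_nonpos (convex_Icc r₁ r₂)
        (fun r hr => (hF r hr).continuousAt.continuousWithinAt)
        (fun r hr => (hF r (interior_subset hr)).hasDerivWithinAt)
        (fun r hr => hF_nonpos r (interior_subset hr))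
    have hle := hanti hm₁ hm₂ h₁₂
    have hdiv : r₂ / (c * K) - r₁ / (c * K) = K / 2 := by
      field_simp
      linarith
    have hu₁ := (abs_le.1 (hlip r₁ (hsub' r₁ hm₁))).2
    have hu₂ := (abs_le.1 (hlip r₂ (hsub' r₂ hm₂))).1
    dsimp only at hle
    nlinarith
  exact abs_le.2 ⟨by linarith [key (-1) (by norm_num)], by linarith [key 1 (by norm_num)]⟩
end

section
/- Let c > 0. Let u : ℝ → ℝ be twice continuously differentiable on [0,1] with u'' ≤ 0 and |u'| ≤ 1 on [0,1], and with u(r) ≥ c·r for all r ∈ [0,1]. Let g : ℝ → ℝ be differentiable on (0,1] with g'(r)² ≤ −u''(r)/u(r) for all r ∈ (0,1]. Then for every r₁ ∈ (0,1], |g(1) − g(r₁)| ≤ √((2/c)·ln(1/r₁)). -/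
/-- If `x ^ 2` is at most `a * b`, then the weighted AM-GM inequality bounds `|x|`. -/
theorem abs_le_weighted_mean_of_sq_le_mul {x a b t : ℝ} (ht : 0 < t) (ha : 0 ≤ a) (hb : 0 ≤ b)
    (h : x ^ 2 ≤ a * b) : |x| ≤ (t * a + b / t) / 2 := by
  refine abs_le_of_sq_le_sq (h.trans ?_) (by positivity)
  have hab : (t * a) * (b / t) = a * b := by field_simp
  nlinarith [sq_nonneg (t * a - b / t)]

/-- The increment of a function is bounded by that of any function whose derivative dominates
the absolute value of its derivative. -/
theorem abs_sub_le_sub_of_abs_deriv_le_s13 {f f' B B' : ℝ → ℝ} {a b : ℝ} (hab : a ≤ b)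
    (hf : ∀ x ∈ Set.Icc a b, HasDerivAt f (f' x) x)
    (hB : ∀ x ∈ Set.Icc a b, HasDerivAt B (B' x) x)
    (h : ∀ x ∈ Set.Icc a b, |f' x| ≤ B' x) : |f b - f a| ≤ B b - B a := by
  refine image_norm_le_of_norm_deriv_right_le_deriv_boundary'
    (f := fun x => f x - f a) (f' := f') (B := fun x => B x - B a) (B' := B')
    (fun x hx => ((hf x hx).sub_const _).continuousAt.continuousWithinAt)
    (fun x hx => ((hf x (Set.Ico_subset_Icc_self hx)).sub_const _).hasDerivWithinAt)
    (by simp)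
    (fun x hx => ((hB x hx).sub_const _).continuousAt.continuousWithinAt)
    (fun x hx => ((hB x (Set.Ico_subset_Icc_self hx)).sub_const _).hasDerivWithinAt)
    (fun x hx => h x (Set.Ico_subset_Icc_self hx)) (Set.right_mem_Icc.2 hab)

/-- Endpoint logarithmic oscillation estimate. Let `c > 0`.
Let `u` be twice continuously differentiable on `[0,1]` with `u'' ≤ 0` and
`|u'| ≤ 1` there, and `u(r) ≥ c·r` on `[0,1]`. Let `g` be differentiable on
`(0,1]` with `g'(r)² ≤ −u''(r)/u(r)` there. Then for every `r₁ ∈ (0,1]`,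
`|g(1) − g(r₁)| ≤ √((2/c)·ln(1/r₁))`. -/
theorem endpoint_log_oscillation_estimate (c : ℝ) (hc : 0 < c)
    (u u' u'' g g' : ℝ → ℝ)
    (hu' : ∀ r ∈ Set.Icc (0 : ℝ) 1, HasDerivAt u (u' r) r)
    (hu'' : ∀ r ∈ Set.Icc (0 : ℝ) 1, HasDerivAt u' (u'' r) r)
    (hu''cont : ContinuousOn u'' (Set.Icc (0 : ℝ) 1))
    (hconc : ∀ r ∈ Set.Icc (0 : ℝ) 1, u'' r ≤ 0)
    (hlip : ∀ r ∈ Set.Icc (0 : ℝ) 1, |u' r| ≤ 1)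
    (hlow : ∀ r ∈ Set.Icc (0 : ℝ) 1, c * r ≤ u r)
    (hg : ∀ r ∈ Set.Ioc (0 : ℝ) 1, HasDerivAt g (g' r) r)
    (hgrad : ∀ r ∈ Set.Ioc (0 : ℝ) 1, (g' r) ^ 2 ≤ -(u'' r) / u r) :
    ∀ r₁ ∈ Set.Ioc (0 : ℝ) 1,
      |g 1 - g r₁| ≤ Real.sqrt ((2 / c) * Real.log (1 / r₁)) := by
  intro r₁ hr₁
  obtain ⟨hr₁0, hr₁1⟩ := hr₁
  have bound : ∀ t : ℝ, 0 < t → |g 1 - g r₁| ≤ t + Real.log (1 / r₁) / (2 * c * t) := by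
    intro t ht
    have key := abs_sub_le_sub_of_abs_deriv_le_s13 (f := g) (f' := g')
      (B := fun r => (t * -u' r + (1 / c * Real.log r) / t) / 2)
      (B' := fun r => (t * -u'' r + (1 / c * r⁻¹) / t) / 2) hr₁1
      (fun r hr => hg r ⟨hr₁0.trans_le hr.1, hr.2⟩)
      (fun r hr => by
        have hr0 : 0 < r := hr₁0.trans_le hr.1
        exact ((((hu'' r ⟨hr0.le, hr.2⟩).neg).const_mul t).add
          (((Real.hasDerivAt_log hr0.ne').const_mul (1 / c)).div_const t)).div_const 2)
      (fun r hr => by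
        have hr0 : 0 < r := hr₁0.trans_le hr.1
        have hA : 0 ≤ -u'' r := neg_nonneg.2 (hconc r ⟨hr0.le, hr.2⟩)
        refine abs_le_weighted_mean_of_sq_le_mul ht hA (by positivity) ?_
        calc g' r ^ 2 ≤ -u'' r / u r := hgrad r ⟨hr0, hr.2⟩
          _ ≤ -u'' r / (c * r) :=
            div_le_div_of_nonneg_left hA (by positivity) (hlow r ⟨hr0.le, hr.2⟩)
          _ = -u'' r * (1 / c * r⁻¹) := by field_simp)
    have hleft := (abs_le.1 (hlip r₁ ⟨hr₁0.le, hr₁1⟩)).2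
    have hright := (abs_le.1 (hlip 1 (by simp))).1
    have hlog : (1 / c * Real.log r₁) / t / 2 = -(Real.log (1 / r₁) / (2 * c * t)) := by
      rw [one_div r₁, Real.log_inv]
      field_simp
    simp only [Real.log_one, mul_zero, zero_div, add_zero] at key
    nlinarith [mul_le_mul_of_nonneg_left hleft ht.le, mul_le_mul_of_nonneg_left hright ht.le]
  rcases hr₁1.eq_or_lt with rfl | hlt
  · simp
  have hL : 0 < Real.log (1 / r₁) := Real.log_pos (one_lt_one_div hr₁0 hlt)
  set s := Real.sqrt ((2 / c) * Real.log (1 / r₁)) with hs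
  have hs0 : 0 < s := Real.sqrt_pos.2 (by positivity)
  have hs2 : s ^ 2 = (2 / c) * Real.log (1 / r₁) := Real.sq_sqrt (by positivity)
  have hLs : Real.log (1 / r₁) = c * s ^ 2 / 2 := by rw [hs2]; field_simp
  refine (bound (s / 2) (by positivity)).trans_eq ?_
  rw [hLs]
  field_simp
  ring
end

section
/- Let 0 < α < 1 and let ρ₀ > 0 satisfy ρ₀ ≤ √(1+α²)·α^{α/(1−α)}. If x, y ∈ ℝ satisfy x² + y² ≤ ρ₀² and α·|x| ≤ |y| ≤ (1/α)·|x|, then |x|^{1/α} ≤ |y| and |y|^{1/α} ≤ |x|. In particular, every such point with xy ≠ 0 lies in the pure cone where |y|/|x|^{1/α} ≥ 1 and |x|/|y|^{1/α} ≥ 1. -/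
/-- A point of the first quadrant above the line of slope `α` and inside the disc of radius
`√(1 + α²) · α^{α/(1-α)}` lies above the curve `b = a^{1/α}`. -/
theorem rpow_one_div_le_of_mul_le {α a b : ℝ} (hα0 : 0 < α) (hα1 : α < 1) (ha : 0 ≤ a)
    (hab : α * a ≤ b)
    (h : a ^ 2 + b ^ 2 ≤ (1 + α ^ 2) * (α ^ (α / (1 - α))) ^ 2) :
    a ^ (1 / α) ≤ b := by
  have h1α : 0 < 1 - α := sub_pos.2 hα1
  have hac : a ≤ α ^ (α / (1 - α)) := by
    refine (sq_le_sq₀ ha (by positivity)).1 ?_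
    have hsq : (α * a) ^ 2 ≤ b ^ 2 := by gcongr
    refine le_of_mul_le_mul_left ?_ (show 0 < 1 + α ^ 2 by positivity)
    linarith
  have hpow : a ^ ((1 - α) / α) ≤ α := by
    calc a ^ ((1 - α) / α) ≤ (α ^ (α / (1 - α))) ^ ((1 - α) / α) := by gcongr
      _ = α := by
        rw [← Real.rpow_mul hα0.le, div_mul_div_cancel₀ h1α.ne', div_self hα0.ne',
          Real.rpow_one]
  calc a ^ (1 / α) = a ^ ((1 - α) / α) * a := by
        rw [show 1 / α = (1 - α) / α + 1 by field_simp; ring,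
          Real.rpow_add_one' ha (by positivity)]
    _ ≤ α * a := by gcongr
    _ ≤ b := hab

/-- Tangent-space inclusion of the wedge into the pure cone.
Let `0 < α < 1` and `0 < ρ₀ ≤ √(1+α²)·α^{α/(1−α)}`. If `x² + y² ≤ ρ₀²` and
`α·|x| ≤ |y| ≤ (1/α)·|x|`, then `|x|^{1/α} ≤ |y|` and `|y|^{1/α} ≤ |x|`.
In particular, when `xy ≠ 0` the point lies in the pure cone where
`|y|/|x|^{1/α} ≥ 1` and `|x|/|y|^{1/α} ≥ 1`. -/
theorem wedge_in_pure_cone (α ρ₀ : ℝ) (hα0 : 0 < α) (hα1 : α < 1)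
    (hρ₀ : 0 < ρ₀)
    (hρ₀small : ρ₀ ≤ Real.sqrt (1 + α ^ 2) * α ^ (α / (1 - α)))
    (x y : ℝ)
    (hxy : x ^ 2 + y ^ 2 ≤ ρ₀ ^ 2)
    (h1 : α * |x| ≤ |y|) (h2 : |y| ≤ (1 / α) * |x|) :
    (|x| ^ (1 / α) ≤ |y| ∧ |y| ^ (1 / α) ≤ |x|) ∧
      (x * y ≠ 0 → 1 ≤ |y| / |x| ^ (1 / α) ∧ 1 ≤ |x| / |y| ^ (1 / α)) := by
  have hsq : |x| ^ 2 + |y| ^ 2 ≤ (1 + α ^ 2) * (α ^ (α / (1 - α))) ^ 2 := by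
    calc |x| ^ 2 + |y| ^ 2 = x ^ 2 + y ^ 2 := by rw [sq_abs, sq_abs]
      _ ≤ ρ₀ ^ 2 := hxy
      _ ≤ (Real.sqrt (1 + α ^ 2) * α ^ (α / (1 - α))) ^ 2 := by gcongr
      _ = (1 + α ^ 2) * (α ^ (α / (1 - α))) ^ 2 := by
        rw [mul_pow, Real.sq_sqrt (by positivity)]
  have h2' : α * |y| ≤ |x| := by
    rwa [one_div, le_inv_mul_iff₀ hα0] at h2
  have hx := rpow_one_div_le_of_mul_le hα0 hα1 (abs_nonneg x) h1 hsq
  have hy := rpow_one_div_le_of_mul_le hα0 hα1 (abs_nonneg y) h2' (by rwa [add_comm])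
  refine ⟨⟨hx, hy⟩, fun hne => ?_⟩
  have hx0 : 0 < |x| := abs_pos.2 (left_ne_zero_of_mul hne)
  have hy0 : 0 < |y| := abs_pos.2 (right_ne_zero_of_mul hne)
  exact ⟨(one_le_div (Real.rpow_pos_of_pos hx0 _)).2 hx,
    (one_le_div (Real.rpow_pos_of_pos hy0 _)).2 hy⟩
end
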